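/- arXiv:2504.12175 — 4 statements merged into one kernel-verified Lean document; each statement's English description precedes it below -/
import Mathlib

section
/- Let d_x, n ∈ ℕ, γ ∈ (0,1], K_H > 0, p ∈ [1,∞) and ε ∈ (0,1). For every function F: [0,1]^{d_x×n} → ℝ^{d_x×n} such that each entry function F_{i,j} belongs to the Hölder class H^γ([0,1]^{d_x×n}, K_H), there exists a Transformer network N ∈ T_{d_x,d_x}(D, H, S, W, L) with D = d_x, H = 1, S = 1, W = 5n·⌈ε^{−d_x n/γ}⌉ and L = 2, such that ‖N − F‖_{L^p} ≤ 4 (d_x n)^2 K_H ε. -/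
open MeasureTheory Matrix

noncomputable section

/-- The column-wise softmax `σ_S`. -/
noncomputable def softmaxCol {d n : ℕ} (A : Matrix (Fin d) (Fin n) ℝ) :
    Matrix (Fin d) (Fin n) ℝ :=
  Matrix.of fun i j => Real.exp (A i j) / ∑ k, Real.exp (A k j)

/-- The entrywise ReLU `σ_R`. -/
def reluM {d n : ℕ} (A : Matrix (Fin d) (Fin n) ℝ) : Matrix (Fin d) (Fin n) ℝ :=
  Matrix.of fun i j => max (A i j) 0

/-- A self-attention layer with `H` heads of head size `S` on `ℝ^{D×n}`. -/
def IsSelfAttn (n D H S : ℕ)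
    (f : Matrix (Fin D) (Fin n) ℝ → Matrix (Fin D) (Fin n) ℝ) : Prop :=
  ∃ (WV WK WQ : Fin H → Matrix (Fin S) (Fin D) ℝ)
    (WO : Fin H → Matrix (Fin D) (Fin S) ℝ),
    ∀ Z, f Z = Z + ∑ h, WO h * ((WV h * Z) * softmaxCol ((WK h * Z)ᵀ * (WQ h * Z)))

/-- A feed-forward layer with hidden dimension `W` on `ℝ^{D×n}`. -/
def IsFeedForward (n D W : ℕ)
    (f : Matrix (Fin D) (Fin n) ℝ → Matrix (Fin D) (Fin n) ℝ) : Prop :=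
  ∃ (W1 : Matrix (Fin W) (Fin D) ℝ) (W2 : Matrix (Fin D) (Fin W) ℝ)
    (b1 : Fin W → ℝ) (b2 : Fin D → ℝ),
    ∀ Z, f Z = Z + W2 * reluM (W1 * Z + Matrix.of fun i _ => b1 i) +
      Matrix.of fun i _ => b2 i

/-- Membership in the transformer class `T_{dx,dy}(D,H,S,W,L)` with sequence length `n`. -/
def IsTransformer (n dx dy D H S W L : ℕ)
    (f : Matrix (Fin dx) (Fin n) ℝ → Matrix (Fin dy) (Fin n) ℝ) : Prop :=
  ∃ (Ain : Matrix (Fin D) (Fin dx) ℝ) (P : Matrix (Fin D) (Fin n) ℝ)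
    (Aout : Matrix (Fin dy) (Fin D) ℝ)
    (SA FF : Fin L → Matrix (Fin D) (Fin n) ℝ → Matrix (Fin D) (Fin n) ℝ),
    (∀ l, IsSelfAttn n D H S (SA l)) ∧ (∀ l, IsFeedForward n D W (FF l)) ∧
    ∀ X, f X = Aout * Fin.foldl L (fun Z l => FF l (SA l Z)) (Ain * X + P)

/-- The Frobenius norm of a real matrix. -/
noncomputable def frobNorm {d n : ℕ} (A : Matrix (Fin d) (Fin n) ℝ) : ℝ :=
  Real.sqrt (∑ i, ∑ j, (A i j) ^ 2)

/-- The unit cube `[0,1]^{d×n}` of matrices. -/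
def unitCube (d n : ℕ) : Set (Matrix (Fin d) (Fin n) ℝ) :=
  {X | ∀ i j, X i j ∈ Set.Icc (0 : ℝ) 1}

/-- The Hölder class `H^γ(Ω, K)`: the sum of the sup-norm and the `γ`-Hölder seminorm
(w.r.t. the Frobenius norm) is at most `K`. -/
def HolderClass {d n : ℕ} (γ K : ℝ) (Ω : Set (Matrix (Fin d) (Fin n) ℝ))
    (f : Matrix (Fin d) (Fin n) ℝ → ℝ) : Prop :=
  ∃ C1 C2 : ℝ, 0 ≤ C1 ∧ 0 ≤ C2 ∧ C1 + C2 ≤ K ∧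
    (∀ X ∈ Ω, |f X| ≤ C1) ∧
    ∀ X ∈ Ω, ∀ Y ∈ Ω, |f X - f Y| ≤ C2 * frobNorm (X - Y) ^ γ

noncomputable instance matrixMeasureSpace {d n : ℕ} :
    MeasureSpace (Matrix (Fin d) (Fin n) ℝ) :=
  inferInstanceAs (MeasureSpace (Fin d → Fin n → ℝ))

/-- The `L^p` norm over the unit cube of a matrix-valued map, measured in Frobenius norm. -/
noncomputable def lpNormCube {d n : ℕ} (p : ℝ)
    (G : Matrix (Fin d) (Fin n) ℝ → Matrix (Fin d) (Fin n) ℝ) : ℝ :=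
  (∫ X in unitCube d n, frobNorm (G X) ^ p) ^ (1 / p)

end


section Helpers

lemma isFF_aux {n D W : ℕ} {ι : Type} [Fintype ι] (hc : Fintype.card ι ≤ W)
    (w1 : ι → Fin D → ℝ) (w2 : Fin D → ι → ℝ) (b : ι → ℝ) :
    IsFeedForward n D W (fun Z => Matrix.of fun i j =>
      Z i j + ∑ k, w2 i k * max (∑ l, w1 k l * Z l j + b k) 0) := by
  have hcard : Fintype.card (Fin W) = Fintype.card (ι ⊕ Fin (W - Fintype.card ι)) := by
    simp; omega
  let e := Fintype.equivOfCardEq hcard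
  refine ⟨Matrix.of fun a l => Sum.elim (fun k => w1 k l) (fun _ => 0) (e a),
    Matrix.of fun i a => Sum.elim (fun k => w2 i k) (fun _ => 0) (e a),
    fun a => Sum.elim b (fun _ => 0) (e a), 0, ?_⟩
  intro Z
  ext i j
  simp only [Matrix.of_apply, Matrix.add_apply, Matrix.mul_apply, reluM, Pi.zero_apply, add_zero]
  congr 1
  symm
  rw [← Equiv.sum_comp e.symm]
  simp

lemma isSA_zero {n D : ℕ} : IsSelfAttn n D 1 1 (fun Z => Z) :=
  ⟨0, 0, 0, 0, by intro Z; simp⟩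

lemma isSA_unif {n D : ℕ} (hn : 0 < n) (o v : Fin D → ℝ) :
    IsSelfAttn n D 1 1 (fun Z => Matrix.of fun i j =>
      Z i j + o i * ∑ l, v l * ∑ k, Z l k) := by
  refine ⟨fun _ => Matrix.of fun _ l => v l, 0, 0, fun _ => Matrix.of fun i _ => n * o i, ?_⟩
  intro Z
  have hn' : (n : ℝ) ≠ 0 := by positivity
  ext i j
  have hs : ∀ A : Matrix (Fin n) (Fin n) ℝ, A = 0 → ∀ a b, softmaxCol A a b = 1 / (n : ℝ) := by
    intro A hA a b
    simp [softmaxCol, hA]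
  rw [Fintype.sum_unique, Matrix.add_apply, Matrix.mul_apply, Fintype.sum_unique,
    Matrix.mul_apply]
  simp only [hs _ (show ((0 : Fin 1 → Matrix (Fin 1) (Fin D) ℝ) default * Z)ᵀ *
      ((0 : Fin 1 → Matrix (Fin 1) (Fin D) ℝ) default * Z) = 0 by simp),
    Matrix.mul_apply, Matrix.of_apply]
  rw [← Finset.sum_mul, Finset.sum_comm]
  simp_rw [Finset.mul_sum]
  rw [Finset.sum_mul, Finset.mul_sum]
  refine congrArg _ (Finset.sum_congr rfl fun l _ => ?_)
  rw [Finset.sum_mul, Finset.mul_sum]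
  refine Finset.sum_congr rfl fun k _ => ?_
  field_simp

/-- clamp to `[0,1]` by two ReLUs -/
lemma clamp_abs (t : ℝ) : |max t 0 - max (t - 1) 0| ≤ 1 := by
  rw [abs_le]
  rcases max_cases t 0 with h | h <;> rcases max_cases (t - 1) 0 with h' | h' <;>
    constructor <;> linarith

noncomputable def hat (t : ℝ) : ℝ := max (t + 1) 0 - 2 * max t 0 + max (t - 1) 0

lemma hat_abs (t : ℝ) : |hat t| ≤ 1 := by
  unfold hat
  rw [abs_le]
  rcases max_cases t 0 with h | h <;> rcases max_cases (t - 1) 0 with h' | h' <;>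
    rcases max_cases (t + 1) 0 with h'' | h'' <;>
    constructor <;> linarith

lemma hat_zero : hat 0 = 1 := by simp [hat]

lemma hat_nat {a b : ℕ} (h : a ≠ b) : hat ((a : ℝ) - b) = 0 := by
  unfold hat
  rcases Nat.lt_or_gt_of_ne h with h | h
  · have : (a : ℝ) + 1 ≤ b := by exact_mod_cast h
    rw [max_eq_right, max_eq_right, max_eq_right] <;> linarith
  · have : (b : ℝ) + 1 ≤ a := by exact_mod_cast h
    rw [max_eq_left, max_eq_left, max_eq_left] <;> linarith

def theta (n K s : ℕ) : ℕ := (s % K) * K ^ (s / K) + (s / K) * K ^ n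

noncomputable def dlt (n K m : ℕ) : ℝ := (theta n K m : ℝ) - theta n K (m - 1)

lemma sum_dlt (n K s : ℕ) : ∑ m ∈ Finset.range (s + 1), dlt n K m = theta n K s := by
  induction s with
  | zero => simp [dlt, theta]
  | succ s ih => rw [Finset.sum_range_succ, ih]; simp [dlt]

noncomputable def stair (n K : ℕ) (η t : ℝ) : ℝ :=
  ∑ m : Fin (n * K), dlt n K m * (max ((t - m) / η) 0 - max ((t - m) / η - 1) 0)

lemma stair_abs (n K : ℕ) (η t : ℝ) : |stair n K η t| ≤ ∑ m : Fin (n * K), |dlt n K m| := by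
  unfold stair
  refine (Finset.abs_sum_le_sum_abs _ _).trans (Finset.sum_le_sum fun m _ => ?_)
  rw [abs_mul]
  exact mul_le_of_le_one_right (abs_nonneg _) (clamp_abs _)

lemma stair_eq (n K : ℕ) {η t : ℝ} (hη : 0 < η) (s : ℕ) (hs : s < n * K)
    (h1 : (s : ℝ) + η ≤ t) (h2 : t ≤ s + 1) : stair n K η t = theta n K s := by
  unfold stair
  rw [Fin.sum_univ_eq_sum_range
    (fun m => dlt n K m * (max ((t - m) / η) 0 - max ((t - m) / η - 1) 0)), ← sum_dlt]
  rw [← Finset.sum_subset (s₁ := Finset.range (s + 1))]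
  · refine Finset.sum_congr rfl fun m hm => ?_
    have hm' : (m : ℝ) ≤ s := by
      have := Finset.mem_range.1 hm
      exact_mod_cast Nat.lt_succ_iff.1 this
    have : 1 ≤ (t - m) / η := by rw [le_div_iff₀ hη]; linarith
    rw [max_eq_left, max_eq_left] <;> linarith
  · intro a ha
    simp at ha ⊢; omega
  · intro m _ hm
    have hm' : (s : ℝ) + 1 ≤ m := by
      simp at hm
      exact_mod_cast hm
    have : (t - m) / η ≤ 0 := div_nonpos_of_nonpos_of_nonneg (by linarith) hη.le
    rw [max_eq_right, max_eq_right] <;> linarith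

abbrev Cell (d n K : ℕ) := Fin d → Fin n → Fin K

def z1v {d n K : ℕ} (c : Cell d n K) (i : Fin d) (j : Fin n) : ℕ :=
  theta n K (c i j + K * j)

lemma z1v_eq {d n K : ℕ} (c : Cell d n K) (i : Fin d) (j : Fin n) :
    z1v c i j = c i j * K ^ (j : ℕ) + j * K ^ n := by
  have hK : 0 < K := (c i j).pos
  unfold z1v theta
  rw [Nat.add_mul_mod_self_left, Nat.add_mul_div_left _ _ hK, Nat.mod_eq_of_lt (c i j).2,
    Nat.div_eq_of_lt (c i j).2, zero_add]

def z2v {d n K : ℕ} (c : Cell d n K) (i : Fin d) (j : Fin n) : ℕ :=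
  z1v c i j + n * K ^ n * ∑ l : Fin d, (K ^ n) ^ (l : ℕ) * ∑ k, z1v c l k

lemma z2v_inj {d n K : ℕ} (u : Fin d) {c c' : Cell d n K} {j j' : Fin n}
    (h : z2v c u j = z2v c' u j') : c = c' ∧ j = j' := by
  have hK : 0 < K := (c u j).pos
  have hlt : ∀ (c : Cell d n K) (j : Fin n), (c u j : ℕ) * K ^ (j : ℕ) < K ^ n := by
    intro c j
    calc (c u j : ℕ) * K ^ (j : ℕ) < K * K ^ (j : ℕ) :=
          Nat.mul_lt_mul_of_pos_right (c u j).2 (by positivity)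
      _ = K ^ (j + 1 : ℕ) := by ring
      _ ≤ K ^ n := Nat.pow_le_pow_right hK j.2
  have hz : ∀ (c : Cell d n K) (j : Fin n), z1v c u j < n * K ^ n := by
    intro c j
    rw [z1v_eq]
    have := hlt c j
    have h2 : ((j : ℕ) + 1) * K ^ n ≤ n * K ^ n := Nat.mul_le_mul_right _ j.2
    nlinarith
  have hmod := congrArg (· % (n * K ^ n)) h
  have hdiv := congrArg (· / (n * K ^ n)) h
  have hpos : 0 < n * K ^ n := (Nat.zero_le _).trans_lt (hz c j)
  simp only [z2v, Nat.add_mul_mod_self_left, Nat.mod_eq_of_lt (hz _ _)] at hmod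
  simp only [z2v, Nat.add_mul_div_left _ _ hpos, Nat.div_eq_of_lt (hz _ _), zero_add] at hdiv
  constructor
  · have key : ∀ c : Cell d n K, ∑ l : Fin d, (K ^ n) ^ (l : ℕ) * ∑ k, z1v c l k =
        (finFunctionFinEquiv (fun l => finFunctionFinEquiv (c l)) : ℕ) +
          ∑ l : Fin d, (K ^ n) ^ (l : ℕ) * ∑ k : Fin n, (k : ℕ) * K ^ n := by
      intro c
      simp only [finFunctionFinEquiv_apply, z1v_eq, Finset.sum_add_distrib, mul_add]
      congr 1
      exact Finset.sum_congr rfl fun l _ => mul_comm _ _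
    rw [key, key] at hdiv
    have := finFunctionFinEquiv.injective (Fin.ext (Nat.add_right_cancel hdiv))
    funext l
    exact finFunctionFinEquiv.injective (congrFun this l)
  · rw [z1v_eq, z1v_eq] at hmod
    have := congrArg (· / K ^ n) hmod
    simp only [Nat.add_mul_div_right _ _ (Nat.pow_pos hK), Nat.div_eq_of_lt (hlt _ _),
      zero_add] at this
    exact Fin.ext this

lemma build {d n K W : ℕ} (hd : 0 < d) (hn : 0 < n) (hK : 0 < K)
    (hW1 : d * (n * K) * 3 ≤ W) (hW2 : (K ^ n) ^ d * n * 3 ≤ W)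
    (T : Cell d n K → Matrix (Fin d) (Fin n) ℝ) :
    ∃ B : ℝ, ∀ η : ℝ, 0 < η → ∃ N, IsTransformer n d d d 1 1 W 2 N ∧
      (∀ X ∈ unitCube d n, ∀ i j, |N X i j| ≤ B) ∧
      ∀ X ∈ unitCube d n, ∀ c : Cell d n K,
        (∀ i j, (c i j : ℝ) + η ≤ K * X i j ∧ K * X i j ≤ c i j + 1) → N X = T c := by
  let u : Fin d := ⟨0, hd⟩
  let o : ℝ := n * (K : ℝ) ^ n
  let v : Fin d → ℝ := fun l => ((K : ℝ) ^ n) ^ (l : ℕ)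
  let B1 : ℝ := ∑ m : Fin (n * K), |dlt n K m|
  let B2 : ℝ := B1 + o * ∑ l, v l * ∑ _k : Fin n, B1
  let B3 : ℝ := B2 + ∑ i : Fin d, ∑ q : Cell d n K × Fin n, |T q.1 i q.2 - z2v q.1 i q.2|
  refine ⟨B3, fun η hη => ?_⟩
  let f1 : Matrix (Fin d) (Fin n) ℝ → Matrix (Fin d) (Fin n) ℝ := fun Z => Matrix.of fun i j =>
    Z i j + ∑ k : Fin d × Fin (n * K) × Fin 3,
      (if i = k.1 then ![dlt n K k.2.1, - dlt n K k.2.1, - 1 / ((n * K : ℕ) : ℝ)] k.2.2 else 0) *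
      max (∑ l, (if l = k.1 then ![1 / η, 1 / η, 1] k.2.2 else 0) * Z l j +
        ![- (k.2.1 : ℝ) / η, - (k.2.1 : ℝ) / η - 1, 0] k.2.2) 0
  let f2 : Matrix (Fin d) (Fin n) ℝ → Matrix (Fin d) (Fin n) ℝ := fun Z => Matrix.of fun i j =>
    Z i j + ∑ k : (Cell d n K × Fin n) × Fin 3,
      ((T k.1.1 i k.1.2 - z2v k.1.1 i k.1.2) * ![1, -2, 1] k.2) *
      max (∑ l, (if l = u then 1 else 0) * Z l j +
        (- (z2v k.1.1 u k.1.2 : ℝ) + ![1, 0, -1] k.2)) 0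
  let s2 : Matrix (Fin d) (Fin n) ℝ → Matrix (Fin d) (Fin n) ℝ := fun Z => Matrix.of fun i j =>
    Z i j + o * ∑ l, v l * ∑ k, Z l k
  let z0 : Matrix (Fin d) (Fin n) ℝ → Matrix (Fin d) (Fin n) ℝ := fun X =>
    ((K : ℝ) • (1 : Matrix (Fin d) (Fin d) ℝ)) * X + Matrix.of fun _ (j : Fin n) => (K : ℝ) * ((j : ℕ) : ℝ)
  have hf1 : IsFeedForward n d W f1 := by
    refine isFF_aux (ι := Fin d × Fin (n * K) × Fin 3) ?_
      (fun k l => if l = k.1 then ![1 / η, 1 / η, 1] k.2.2 else 0)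
      (fun i k => if i = k.1 then
        ![dlt n K k.2.1, - dlt n K k.2.1, - 1 / ((n * K : ℕ) : ℝ)] k.2.2 else 0)
      (fun k => ![- (k.2.1 : ℝ) / η, - (k.2.1 : ℝ) / η - 1, 0] k.2.2)
    simp only [Fintype.card_prod, Fintype.card_fin]
    linarith
  have hf2 : IsFeedForward n d W f2 := by
    refine isFF_aux (ι := (Cell d n K × Fin n) × Fin 3) ?_
      (fun k l => if l = u then 1 else 0)
      (fun i k => (T k.1.1 i k.1.2 - z2v k.1.1 i k.1.2) * ![1, -2, 1] k.2)
      (fun k => - (z2v k.1.1 u k.1.2 : ℝ) + ![1, 0, -1] k.2)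
    simpa using hW2
  have hs2 : IsSelfAttn n d 1 1 s2 := isSA_unif hn (fun _ => o) v
  -- evaluation of the layers
  have ez0 : ∀ X i j, z0 X i j = K * X i j + K * (j : ℕ) := by
    intro X i j; simp [z0]
  have hnK : ((n * K : ℕ) : ℝ) ≠ 0 := by positivity
  have ef1 : ∀ Z i j, 0 ≤ Z i j → f1 Z i j = stair n K η (Z i j) := by
    intro Z i j hZ
    simp only [f1, Matrix.of_apply, Fintype.sum_prod_type, ite_mul, zero_mul,
      Finset.sum_ite_eq', Finset.mem_univ, if_true, Fin.sum_univ_three]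
    rw [Finset.sum_eq_single i]
    · simp only [if_true, Matrix.cons_val]
      rw [Finset.sum_add_distrib, Finset.sum_const, Finset.card_univ, Fintype.card_fin,
        nsmul_eq_mul, one_mul, add_zero, max_eq_left hZ]
      have : ((n * K : ℕ) : ℝ) * (-1 / ((n * K : ℕ) : ℝ) * Z i j) = - Z i j := by
        field_simp
      rw [this, stair]
      have e : ∀ m : Fin (n * K), dlt n K m * max (1 / η * Z i j + -(m : ℝ) / η) 0 +
          -dlt n K m * max (1 / η * Z i j + (-(m : ℝ) / η - 1)) 0 =
          dlt n K m * (max ((Z i j - m) / η) 0 - max ((Z i j - m) / η - 1) 0) := by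
        intro m
        rw [show 1 / η * Z i j + -(m : ℝ) / η = (Z i j - m) / η by ring,
          show 1 / η * Z i j + (-(m : ℝ) / η - 1) = (Z i j - m) / η - 1 by ring]
        ring
      simp_rw [e]
      ring
    · intro b _ hb
      simp [hb.symm]
    · simp
  have ef2 : ∀ Z i j, f2 Z i j = Z i j + ∑ q : Cell d n K × Fin n,
      (T q.1 i q.2 - z2v q.1 i q.2) * hat (Z u j - z2v q.1 u q.2) := by
    intro Z i j
    simp only [f2, Matrix.of_apply]
    congr 1
    rw [Fintype.sum_prod_type]
    refine Finset.sum_congr rfl fun q _ => ?_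
    simp only [ite_mul, zero_mul, one_mul,
      Finset.sum_ite_eq', Finset.mem_univ, if_true, Fin.sum_univ_three, Matrix.cons_val, hat]
    rw [show Z u j + (-(z2v q.1 u q.2 : ℝ) + 1) = Z u j - z2v q.1 u q.2 + 1 by ring,
      show Z u j + (-(z2v q.1 u q.2 : ℝ) + 0) = Z u j - z2v q.1 u q.2 by ring,
      show Z u j + (-(z2v q.1 u q.2 : ℝ) + -1) = Z u j - z2v q.1 u q.2 - 1 by ring]
    ring
  have hpos : ∀ X ∈ unitCube d n, ∀ i j, 0 ≤ z0 X i j := by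
    intro X hX i j
    rw [ez0]
    have := (hX i j).1
    positivity
  have ho : 0 ≤ o := by positivity
  have hv : ∀ l, 0 ≤ v l := fun l => by positivity
  refine ⟨fun X => f2 (s2 (f1 (z0 X))), ?_, ?_, ?_⟩
  · refine ⟨(K : ℝ) • (1 : Matrix (Fin d) (Fin d) ℝ), Matrix.of fun _ (j : Fin n) => (K : ℝ) * ((j : ℕ) : ℝ), 1,
      ![fun Z => Z, s2], ![f1, f2], ?_, ?_, ?_⟩
    · intro l
      fin_cases l
      · exact isSA_zero
      · exact hs2
    · intro l
      fin_cases l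
      · exact hf1
      · exact hf2
    · intro X
      simp [Fin.foldl_succ, z0]
  · intro X hX i j
    have b1 : ∀ i j, |f1 (z0 X) i j| ≤ B1 := by
      intro i j
      rw [ef1 _ _ _ (hpos X hX i j)]
      exact stair_abs _ _ _ _
    have b2 : ∀ i j, |s2 (f1 (z0 X)) i j| ≤ B2 := by
      intro i j
      simp only [s2, Matrix.of_apply]
      refine (abs_add_le _ _).trans (add_le_add (b1 i j) ?_)
      rw [abs_mul, abs_of_nonneg ho]
      refine mul_le_mul_of_nonneg_left ?_ ho
      refine (Finset.abs_sum_le_sum_abs _ _).trans (Finset.sum_le_sum fun l _ => ?_)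
      rw [abs_mul, abs_of_nonneg (hv l)]
      refine mul_le_mul_of_nonneg_left ?_ (hv l)
      exact (Finset.abs_sum_le_sum_abs _ _).trans (Finset.sum_le_sum fun k _ => b1 l k)
    change |f2 (s2 (f1 (z0 X))) i j| ≤ B3
    rw [ef2]
    refine (abs_add_le _ _).trans (add_le_add (b2 i j) ?_)
    refine (Finset.abs_sum_le_sum_abs _ _).trans ?_
    refine le_trans (b := ∑ q : Cell d n K × Fin n, |T q.1 i q.2 - z2v q.1 i q.2|) ?_ ?_
    · refine Finset.sum_le_sum fun q _ => ?_
      rw [abs_mul]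
      exact mul_le_of_le_one_right (abs_nonneg _) (hat_abs _)
    · exact Finset.single_le_sum
        (f := fun i => ∑ q : Cell d n K × Fin n, |T q.1 i q.2 - z2v q.1 i q.2|)
        (fun i _ => Finset.sum_nonneg fun q _ => abs_nonneg _) (Finset.mem_univ i)
  · intro X hX c hc
    have v1 : ∀ i j, f1 (z0 X) i j = z1v c i j := by
      intro i j
      rw [ef1 _ _ _ (hpos X hX i j), z1v]
      have := hc i j
      refine stair_eq n K hη _ ?_ ?_ ?_
      · have h1 := (c i j).2
        have h2 : ((j : ℕ) + 1) * K ≤ n * K := Nat.mul_le_mul_right _ j.2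
        nlinarith
      · rw [ez0]; push_cast; linarith
      · rw [ez0]; push_cast; linarith
    have v2 : ∀ i j, s2 (f1 (z0 X)) i j = z2v c i j := by
      intro i j
      simp only [s2, Matrix.of_apply, v1, z2v, o, v]
      push_cast
      ring
    ext i j
    change f2 (s2 (f1 (z0 X))) i j = T c i j
    rw [ef2]
    simp only [v2]
    rw [Finset.sum_eq_single (c, j)]
    · simp [hat_zero]
    · intro q _ hq
      rw [hat_nat, mul_zero]
      intro h
      obtain ⟨h1, h2⟩ := z2v_inj u h
      exact hq (Prod.ext h1.symm h2.symm)
    · simp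

lemma frob_le {d n : ℕ} (A : Matrix (Fin d) (Fin n) ℝ) {e : ℝ} (he : 0 ≤ e)
    (h : ∀ i j, |A i j| ≤ e) : frobNorm A ≤ (d : ℝ) * n * e := by
  unfold frobNorm
  rw [Real.sqrt_le_iff]
  refine ⟨by positivity, ?_⟩
  have h1 : ∑ i, ∑ j, (A i j) ^ 2 ≤ ∑ _i : Fin d, ∑ _j : Fin n, e ^ 2 :=
    Finset.sum_le_sum fun i _ => Finset.sum_le_sum fun j _ =>
      sq_le_sq' (by linarith [(abs_le.1 (h i j)).1]) (abs_le.1 (h i j)).2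
  refine h1.trans ?_
  simp only [Finset.sum_const, Finset.card_univ, Fintype.card_fin, nsmul_eq_mul]
  have h2 : ((d * n : ℕ) : ℝ) ≤ ((d * n : ℕ) : ℝ) ^ 2 := by
    exact_mod_cast Nat.le_self_pow two_ne_zero _
  push_cast at h2
  calc (d : ℝ) * (n * e ^ 2) = (d * n) * e ^ 2 := by ring
    _ ≤ (d * n) ^ 2 * e ^ 2 := by gcongr
    _ = _ := by ring

lemma frob_nonneg {d n : ℕ} (A : Matrix (Fin d) (Fin n) ℝ) : 0 ≤ frobNorm A :=
  Real.sqrt_nonneg _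

lemma vol_cube (d n : ℕ) : volume (unitCube d n) = 1 := by
  have : unitCube d n = (Set.univ.pi fun _ : Fin d => Set.univ.pi fun _ : Fin n =>
      Set.Icc (0 : ℝ) 1 : Set (Fin d → Fin n → ℝ)) := by
    ext X
    exact ⟨fun h i _ j _ => h i j, fun h i j => h i trivial j trivial⟩
  rw [this]
  change (volume : Measure (Fin d → Fin n → ℝ)) _ = 1
  rw [volume_pi_pi]
  simp only [volume_pi_pi, Real.volume_Icc]
  simp

lemma meas_entry {d n : ℕ} (i : Fin d) (j : Fin n) :
    Measurable fun X : Matrix (Fin d) (Fin n) ℝ => X i j := by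
  have h : Measurable fun X : Fin d → Fin n → ℝ => X i j := by fun_prop
  exact h

lemma meas_cube (d n : ℕ) : MeasurableSet (unitCube d n) := by
  have : unitCube d n = ⋂ i, ⋂ j, (fun X : Matrix (Fin d) (Fin n) ℝ => X i j) ⁻¹'
      Set.Icc (0 : ℝ) 1 := by
    ext X; simp [unitCube]
  rw [this]
  exact MeasurableSet.iInter fun i => MeasurableSet.iInter fun j =>
    meas_entry i j measurableSet_Icc

lemma qmp_entry {d n : ℕ} (i : Fin d) (j : Fin n) :
    Measure.QuasiMeasurePreserving (fun X : Matrix (Fin d) (Fin n) ℝ => X i j) volume volume := by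
  have h : Measure.QuasiMeasurePreserving (fun X : Fin d → Fin n → ℝ => X i j)
      volume volume :=
    (Measure.quasiMeasurePreserving_eval (fun _ : Fin n => (volume : Measure ℝ)) j).comp
      (Measure.quasiMeasurePreserving_eval
        (fun _ : Fin d => (volume : Measure (Fin n → ℝ))) i)
  exact h

def badSet (d n K k : ℕ) : Set (Matrix (Fin d) (Fin n) ℝ) :=
  unitCube d n ∩ ⋃ i, ⋃ j, (fun X => X i j) ⁻¹' {x : ℝ | Int.fract (K * x) < 1 / ((k : ℝ) + 1)}

lemma meas_bad (d n K k : ℕ) : MeasurableSet (badSet d n K k) := by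
  refine (meas_cube d n).inter (MeasurableSet.iUnion fun i => MeasurableSet.iUnion fun j =>
    meas_entry i j ?_)
  exact measurableSet_lt (by fun_prop) measurable_const

lemma bad_tendsto (d n K : ℕ) (hK : 0 < K) :
    Filter.Tendsto (fun k => volume (badSet d n K k)) Filter.atTop (nhds 0) := by
  have hanti : Antitone (badSet d n K) := by
    intro a b hab X hX
    refine ⟨hX.1, ?_⟩
    have h2 := hX.2
    simp only [Set.mem_iUnion, Set.mem_preimage, Set.mem_ofPred_eq] at h2 ⊢
    obtain ⟨i, j, h⟩ := h2
    exact ⟨i, j, h.trans_le (Nat.one_div_le_one_div hab)⟩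
  have hfin : ∀ k, volume (badSet d n K k) ≠ ⊤ := fun k =>
    ((measure_mono Set.inter_subset_left).trans_lt (by rw [vol_cube]; simp)).ne
  have h := tendsto_measure_iInter_atTop (μ := volume) (s := badSet d n K)
    (fun k => (meas_bad d n K k).nullMeasurableSet) hanti ⟨0, hfin 0⟩
  have hz : volume (⋂ k, badSet d n K k) = 0 := by
    have hcount : volume {x : ℝ | Int.fract ((K : ℝ) * x) = 0} = 0 := by
      refine Set.Countable.measure_zero ?_ _
      refine (Set.countable_range fun z : ℤ => (z : ℝ) / K).mono ?_
      intro x hx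
      refine ⟨⌊(K : ℝ) * x⌋, ?_⟩
      have hx' : Int.fract ((K : ℝ) * x) = 0 := hx
      have h1 := Int.floor_add_fract ((K : ℝ) * x)
      have hK' : (K : ℝ) ≠ 0 := by positivity
      rw [hx', add_zero] at h1
      simp only [h1]
      field_simp
    refine measure_mono_null (t := ⋃ i : Fin d, ⋃ j : Fin n,
      (fun X : Matrix (Fin d) (Fin n) ℝ => X i j) ⁻¹'
        {x : ℝ | Int.fract ((K : ℝ) * x) = 0}) ?_ ?_
    · intro X hX
      by_contra hne
      simp only [Set.mem_iUnion, Set.mem_preimage, Set.mem_ofPred_eq, not_exists] at hne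
      have hp : ∀ q : Fin d × Fin n, ∃ k0 : ℕ, ∀ k ≥ k0,
          1 / ((k : ℝ) + 1) < Int.fract ((K : ℝ) * X q.1 q.2) := by
        intro q
        have : 0 < Int.fract ((K : ℝ) * X q.1 q.2) :=
          lt_of_le_of_ne (Int.fract_nonneg _) (Ne.symm (hne q.1 q.2))
        obtain ⟨k0, hk0⟩ := exists_nat_one_div_lt this
        exact ⟨k0, fun k hk => (Nat.one_div_le_one_div hk).trans_lt hk0⟩
      choose k0 hk0 using hp
      have := (Set.mem_iInter.1 hX (Finset.univ.sup k0)).2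
      simp only [Set.mem_iUnion, Set.mem_preimage, Set.mem_ofPred_eq] at this
      obtain ⟨i, j, h⟩ := this
      exact absurd h (not_lt.2 (hk0 (i, j) _ (Finset.le_sup (Finset.mem_univ _))).le)
    · exact measure_iUnion_null fun i => measure_iUnion_null fun j =>
        (qmp_entry i j).preimage_null hcount
  rw [hz] at h
  exact h

lemma lp_bound {d n : ℕ} {p : ℝ} (hp : 1 ≤ p)
    (G : Matrix (Fin d) (Fin n) ℝ → Matrix (Fin d) (Fin n) ℝ)
    (S : Set (Matrix (Fin d) (Fin n) ℝ)) (hS : MeasurableSet S) (hSc : S ⊆ unitCube d n)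
    {c B C : ℝ} (hc : 0 ≤ c) (hB : 0 ≤ B) (hC : 0 ≤ C)
    (h1 : ∀ X ∈ unitCube d n, X ∉ S → frobNorm (G X) ≤ c)
    (h2 : ∀ X ∈ S, frobNorm (G X) ≤ B)
    (h : c ^ p + B ^ p * volume.real S ≤ C ^ p) : lpNormCube p G ≤ C := by
  have hp0 : 0 < p := by linarith
  have hnn : ∀ X, 0 ≤ frobNorm (G X) ^ p := fun X => Real.rpow_nonneg (frob_nonneg _) _
  have key : ∫ X in unitCube d n, frobNorm (G X) ^ p ≤ C ^ p := by
    by_cases hi : IntegrableOn (fun X => frobNorm (G X) ^ p) (unitCube d n)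
    · have hun : unitCube d n = S ∪ (unitCube d n \ S) := by
        rw [Set.union_sdiff_cancel hSc]
      have hfinS : volume S < ⊤ := (measure_mono hSc).trans_lt (by rw [vol_cube]; simp)
      have hfinD : volume (unitCube d n \ S) < ⊤ :=
        (measure_mono Set.sdiff_subset).trans_lt (by rw [vol_cube]; simp)
      have hD1 : volume.real (unitCube d n \ S) ≤ 1 := by
        rw [measureReal_def]
        refine ENNReal.toReal_le_of_le_ofReal zero_le_one ?_
        refine (measure_mono Set.sdiff_subset).trans (by rw [vol_cube]; simp)
      rw [hun, setIntegral_union Set.disjoint_sdiff_right ((meas_cube d n).diff hS)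
        (hi.mono_set hSc) (hi.mono_set Set.sdiff_subset)]
      have e1 : ∫ X in S, frobNorm (G X) ^ p ≤ B ^ p * volume.real S := by
        refine (Real.le_norm_self _).trans (norm_setIntegral_le_of_norm_le_const hfinS ?_)
        intro X hX
        rw [Real.norm_of_nonneg (hnn X)]
        exact Real.rpow_le_rpow (frob_nonneg _) (h2 X hX) hp0.le
      have e2 : ∫ X in unitCube d n \ S, frobNorm (G X) ^ p ≤
          c ^ p * volume.real (unitCube d n \ S) := by
        refine (Real.le_norm_self _).trans (norm_setIntegral_le_of_norm_le_const hfinD ?_)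
        intro X hX
        rw [Real.norm_of_nonneg (hnn X)]
        exact Real.rpow_le_rpow (frob_nonneg _) (h1 X hX.1 hX.2) hp0.le
      have e3 : c ^ p * volume.real (unitCube d n \ S) ≤ c ^ p :=
        mul_le_of_le_one_right (Real.rpow_nonneg hc _) hD1
      linarith
    · rw [integral_undef hi]
      exact Real.rpow_nonneg hC _
  unfold lpNormCube
  calc (∫ X in unitCube d n, frobNorm (G X) ^ p) ^ (1 / p) ≤ (C ^ p) ^ (1 / p) :=
        Real.rpow_le_rpow (integral_nonneg hnn) key (by positivity)
    _ = C := by rw [one_div, Real.rpow_rpow_inv hC hp0.ne']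

end Helpers

/-- (Theorem 4, case `p ∈ [1,∞)`): approximation of entrywise `γ`-Hölder
sequence-to-sequence functions by transformers in the `L^p` norm. -/
theorem transformer_holder_approx_Lp
    (dx n : ℕ) (hdx : 0 < dx) (hn : 0 < n) (γ KH p ε : ℝ)
    (hγ : γ ∈ Set.Ioc (0 : ℝ) 1) (hKH : 0 < KH) (hp : 1 ≤ p) (hε : ε ∈ Set.Ioo (0 : ℝ) 1)
    (F : Matrix (Fin dx) (Fin n) ℝ → Matrix (Fin dx) (Fin n) ℝ)
    (hF : ∀ i j, HolderClass γ KH (unitCube dx n) (fun X => F X i j)) :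
    ∃ N : Matrix (Fin dx) (Fin n) ℝ → Matrix (Fin dx) (Fin n) ℝ,
      IsTransformer n dx dx dx 1 1 (5 * n * ⌈ε ^ (-((dx : ℝ) * n) / γ)⌉₊) 2 N ∧
      lpNormCube p (fun X => N X - F X) ≤ 4 * ((dx : ℝ) * n) ^ 2 * KH * ε := by

  obtain ⟨hγ0, hγ1⟩ := hγ
  obtain ⟨hε0, hε1⟩ := hε
  have hd1 : (1 : ℝ) ≤ dx := by exact_mod_cast hdx
  have hn1 : (1 : ℝ) ≤ n := by exact_mod_cast hn
  have hdn : (1 : ℝ) ≤ (dx : ℝ) * n := by nlinarith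
  have hFb : ∀ X ∈ unitCube dx n, ∀ i j, |F X i j| ≤ KH := by
    intro X hX i j
    obtain ⟨C1, C2, h1, h2, h3, h4, -⟩ := hF i j
    exact (h4 X hX).trans (by linarith)
  have hFh : ∀ X ∈ unitCube dx n, ∀ Y ∈ unitCube dx n, ∀ i j,
      |F X i j - F Y i j| ≤ KH * frobNorm (X - Y) ^ γ := by
    intro X hX Y hY i j
    obtain ⟨C1, C2, h1, h2, h3, -, h5⟩ := hF i j
    exact (h5 X hX Y hY).trans
      (mul_le_mul_of_nonneg_right (by linarith) (Real.rpow_nonneg (frob_nonneg _) _))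
  rcases le_or_gt (1 / 2) ε with hbig | hsmall
  · -- trivial case: the zero network
    refine ⟨fun _ => 0, ⟨0, 0, 0, fun _ Z => Z, fun _ Z => Z, fun _ => isSA_zero,
      fun _ => ⟨0, 0, 0, 0, fun Z => ?_⟩, fun X => by simp⟩, ?_⟩
    · ext i j; simp
    · refine lp_bound hp _ ∅ MeasurableSet.empty (Set.empty_subset _)
        (c := (dx : ℝ) * n * KH) (B := 0) (by positivity) le_rfl (by positivity) ?_ ?_ ?_
      · intro X hX _
        refine frob_le _ hKH.le fun i j => ?_
        simpa using hFb X hX i j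
      · intro X hX; exact absurd hX (Set.notMem_empty X)
      · simp only [measureReal_empty, mul_zero, add_zero]
        refine Real.rpow_le_rpow (by positivity) ?_ (by linarith)
        have : (dx : ℝ) * n ≤ ((dx : ℝ) * n) ^ 2 := by nlinarith
        calc (dx : ℝ) * n * KH ≤ ((dx : ℝ) * n) ^ 2 * KH * 1 := by rw [mul_one]; gcongr
          _ ≤ ((dx : ℝ) * n) ^ 2 * KH * (4 * ε) := by gcongr; linarith
          _ = _ := by ring
  · set x : ℝ := ε ^ (-1 / γ) with hx
    have hx2 : 2 ≤ x := by
      have h1 : ε ^ (-1 : ℝ) ≤ x := by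
        rw [hx]
        refine Real.rpow_le_rpow_of_exponent_ge hε0 hε1.le ?_
        rw [neg_div, neg_le_neg_iff, le_div_iff₀ hγ0]; linarith
      refine le_trans ?_ h1
      rw [Real.rpow_neg_one, le_inv_comm₀ two_pos hε0]
      linarith
    set K : ℕ := ⌊x⌋₊ with hKdef
    have hKle : (K : ℝ) ≤ x := Nat.floor_le (by linarith)
    have hKgt : x < K + 1 := Nat.lt_floor_add_one x
    have hK2 : 2 ≤ K := Nat.le_floor (by exact_mod_cast hx2)
    have hK0 : (0 : ℝ) < K := by positivity
    set G : ℕ := ⌈ε ^ (-((dx : ℝ) * n) / γ)⌉₊ with hG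
    have hKG : (K ^ n) ^ dx ≤ G := by
      have h1 : ((K : ℝ) ^ n) ^ dx ≤ ε ^ (-((dx : ℝ) * n) / γ) := by
        calc ((K : ℝ) ^ n) ^ dx ≤ (x ^ n) ^ dx := by gcongr
          _ = x ^ (((n * dx : ℕ)) : ℝ) := by rw [Real.rpow_natCast, pow_mul]
          _ = _ := by
            rw [hx, ← Real.rpow_mul hε0.le]
            congr 1
            push_cast; ring
      have h2 : (((K ^ n) ^ dx : ℕ) : ℝ) ≤ (G : ℝ) := by
        push_cast
        exact h1.trans (Nat.le_ceil _)
      exact Nat.cast_le.1 h2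
    have hdK : dx * K ≤ (K ^ n) ^ dx := by
      have h1 : dx ≤ K ^ (dx - 1) := by
        have := Nat.lt_pow_self (a := K) (n := dx - 1) hK2
        omega
      calc dx * K ≤ K ^ (dx - 1) * K := Nat.mul_le_mul_right _ h1
        _ = K ^ dx := by rw [← pow_succ]; congr 1; omega
        _ ≤ (K ^ n) ^ dx := Nat.pow_le_pow_left (Nat.le_self_pow hn.ne' _) _
    have hW1 : dx * (n * K) * 3 ≤ 5 * n * G := by
      have : n * (dx * K) ≤ n * G := Nat.mul_le_mul_left _ (hdK.trans hKG)
      nlinarith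
    have hW2 : (K ^ n) ^ dx * n * 3 ≤ 5 * n * G := by
      have : n * (K ^ n) ^ dx ≤ n * G := Nat.mul_le_mul_left _ hKG
      nlinarith
    let cr : Cell dx n K → Matrix (Fin dx) (Fin n) ℝ :=
      fun c => Matrix.of fun i j => ((c i j : ℕ) : ℝ) / K
    have hcr : ∀ c, cr c ∈ unitCube dx n := by
      intro c i j
      simp only [cr, Matrix.of_apply, Set.mem_Icc]
      refine ⟨by positivity, ?_⟩
      rw [div_le_one hK0]
      exact_mod_cast (c i j).2.le
    obtain ⟨B, hB⟩ := build hdx hn (by omega : 0 < K) hW1 hW2 (fun c => F (cr c))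
    set c0 : ℝ := 2 * ((dx : ℝ) * n) ^ 2 * KH * ε with hc0
    have hc0pos : 0 < c0 := by positivity
    let B' : ℝ := (dx : ℝ) * n * (|B| + KH)
    have hB' : 0 ≤ B' := by positivity
    have hp0 : 0 < p := by linarith
    have hgap : 0 < (2 * c0) ^ p - c0 ^ p :=
      sub_pos.2 (Real.rpow_lt_rpow hc0pos.le (by linarith) hp0)
    obtain ⟨k, hk⟩ : ∃ k, B' ^ p * volume.real (badSet dx n K k) < (2 * c0) ^ p - c0 ^ p := by
      have h1 : Filter.Tendsto (fun k => volume.real (badSet dx n K k)) Filter.atTop (nhds 0) := by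
        have := (ENNReal.tendsto_toReal ENNReal.zero_ne_top).comp
          (bad_tendsto dx n K (by omega))
        simpa [measureReal_def, Function.comp_def] using this
      have h2 := h1.const_mul (B' ^ p)
      rw [mul_zero] at h2
      exact (h2.eventually_lt_const hgap).exists
    have hη : 0 < 1 / ((k : ℝ) + 1) := by positivity
    obtain ⟨N, hN, hNb, hNe⟩ := hB _ hη
    refine ⟨N, hN, ?_⟩
    have hfin : 4 * ((dx : ℝ) * n) ^ 2 * KH * ε = 2 * c0 := by rw [hc0]; ring
    rw [hfin]
    refine lp_bound hp _ (badSet dx n K k) (meas_bad _ _ _ _) Set.inter_subset_left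
      hc0pos.le hB' (by positivity) ?_ ?_ (by linarith)
    · intro X hX hbad
      have hgood : ∀ i j, 1 / ((k : ℝ) + 1) ≤ Int.fract ((K : ℝ) * X i j) := by
        intro i j
        by_contra hlt
        exact hbad ⟨hX, Set.mem_iUnion.2 ⟨i, Set.mem_iUnion.2 ⟨j, not_le.1 hlt⟩⟩⟩
      have hnn : ∀ i j, 0 ≤ (K : ℝ) * X i j := fun i j => mul_nonneg hK0.le (hX i j).1
      have hfl : ∀ i j, ((⌊(K : ℝ) * X i j⌋₊ : ℕ) : ℝ) + Int.fract ((K : ℝ) * X i j)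
          = (K : ℝ) * X i j := by
        intro i j
        rw [natCast_floor_eq_intCast_floor (hnn i j)]
        exact Int.floor_add_fract _
      let c : Cell dx n K := fun i j => ⟨⌊(K : ℝ) * X i j⌋₊, by
        have h1 := hfl i j
        have h2 := hgood i j
        have h3 : (K : ℝ) * X i j ≤ K := mul_le_of_le_one_right hK0.le (hX i j).2
        have : ((⌊(K : ℝ) * X i j⌋₊ : ℕ) : ℝ) < K := by linarith
        exact_mod_cast this⟩
      have hcX : ∀ i j, ((c i j : ℕ) : ℝ) + Int.fract ((K : ℝ) * X i j) = K * X i j := hfl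
      have hNX : N X = F (cr c) := by
        refine hNe X hX c fun i j => ⟨?_, ?_⟩
        · linarith [hcX i j, hgood i j]
        · linarith [hcX i j, Int.fract_lt_one ((K : ℝ) * X i j)]
      have hfr : frobNorm (cr c - X) ≤ (dx : ℝ) * n * (2 * ε ^ (1 / γ)) := by
        refine frob_le _ (by positivity) fun i j => ?_
        have e1 : (cr c - X) i j = - (Int.fract ((K : ℝ) * X i j) / K) := by
          simp only [cr, Matrix.sub_apply, Matrix.of_apply]
          have := hcX i j
          field_simp
          linarith
        have e2 : ε ^ (1 / γ) = x⁻¹ := by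
          rw [hx, neg_div, Real.rpow_neg hε0.le, inv_inv]
        rw [e1, abs_neg, abs_of_nonneg (div_nonneg (Int.fract_nonneg _) hK0.le), e2,
          div_le_iff₀ hK0]
        refine (Int.fract_lt_one _).le.trans ?_
        have hx0 : 0 < x := by linarith
        rw [mul_assoc, ← div_eq_inv_mul, ← mul_div_assoc, le_div_iff₀ hx0]
        linarith
      have hfr2 : frobNorm (cr c - X) ^ γ ≤ 2 * ((dx : ℝ) * n) * ε := by
        calc frobNorm (cr c - X) ^ γ ≤ ((2 * ((dx : ℝ) * n)) * ε ^ (1 / γ)) ^ γ :=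
              Real.rpow_le_rpow (frob_nonneg _) (by linarith) hγ0.le
          _ = (2 * ((dx : ℝ) * n)) ^ γ * ε := by
              rw [Real.mul_rpow (by positivity) (by positivity), one_div,
                Real.rpow_inv_rpow hε0.le hγ0.ne']
          _ ≤ (2 * ((dx : ℝ) * n)) ^ (1 : ℝ) * ε := by
              refine mul_le_mul_of_nonneg_right ?_ hε0.le
              exact Real.rpow_le_rpow_of_exponent_le (by linarith) hγ1
          _ = _ := by rw [Real.rpow_one]
      have : c0 = (dx : ℝ) * n * (KH * (2 * ((dx : ℝ) * n) * ε)) := by rw [hc0]; ring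
      rw [this]
      refine frob_le _ (by positivity) fun i j => ?_
      rw [hNX]
      refine (hFh _ (hcr c) X hX i j).trans ?_
      gcongr
    · intro X hX
      refine frob_le _ (by positivity) fun i j => ?_
      rw [Matrix.sub_apply]
      exact (abs_sub _ _).trans (add_le_add ((hNb X hX.1 i j).trans (le_abs_self B))
        (hFb X hX.1 i j))
end

section
/- Let d_x, n ∈ ℕ, γ ∈ (0,1], K_H > 0 and ε ∈ (0,1). For every function F: [0,1]^{d_x×n} → ℝ^{d_x×n} such that each entry function F_{i,j} belongs to the Hölder class H^γ([0,1]^{d_x×n}, K_H), there exists a Transformer network N ∈ T_{d_x,d_x}(D, H, S, W, L) with D = 5·d_x·3^{d_x n}, H = 3^{d_x n}, S = 1, W = 5n·3^{d_x n}·⌈ε^{−d_x n/γ}⌉ and L = 2 + 2 d_x n, such that sup_{X ∈ [0,1]^{d_x×n}} ‖N(X) − F(X)‖_F ≤ 4 (d_x n)^2 K_H ε. -/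
open MeasureTheory Matrix

namespace TransApprox

noncomputable section

/-! ### Embedding generic layers -/

/-- The 0/1 matrix of an embedding of an index type into `Fin D`. -/
def emb {ι : Type} {D : ℕ} (e : ι ↪ Fin D) : Matrix (Fin D) ι ℝ :=
  open Classical in Matrix.of fun d a => if e a = d then 1 else 0

theorem emb_transpose_mul {ι : Type} [Fintype ι] [DecidableEq ι] {D : ℕ} (e : ι ↪ Fin D) :
    (emb e)ᵀ * emb e = 1 := by
  classical
  ext a b
  simp [Matrix.mul_apply, emb, Matrix.one_apply]

theorem emb_cancel {ι : Type} [Fintype ι] [DecidableEq ι] {D n : ℕ} (e : ι ↪ Fin D)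
    (z : Matrix ι (Fin n) ℝ) : (emb e)ᵀ * (emb e * z) = z := by
  rw [← Matrix.mul_assoc, emb_transpose_mul, Matrix.one_mul]

theorem emb_mul_apply {ι : Type} [Fintype ι] {D n : ℕ} (e : ι ↪ Fin D)
    (z : Matrix ι (Fin n) ℝ) (a : ι) (j : Fin n) : (emb e * z) (e a) j = z a j := by
  classical
  simp [Matrix.mul_apply, emb]

theorem emb_mul_apply_not {ι : Type} [Fintype ι] {D n : ℕ} (e : ι ↪ Fin D)
    (z : Matrix ι (Fin n) ℝ) (d : Fin D) (hd : ∀ a, e a ≠ d) (j : Fin n) :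
    (emb e * z) d j = 0 := by
  classical
  simp [Matrix.mul_apply, emb, hd]

theorem relu_emb {κ : Type} [Fintype κ] {W n : ℕ} (g : κ ↪ Fin W)
    (y : Matrix κ (Fin n) ℝ) :
    reluM (emb g * y) = emb g * (Matrix.of fun k j => max (y k j) 0) := by
  ext d j
  by_cases h : ∃ a, g a = d
  · obtain ⟨a, rfl⟩ := h
    rw [emb_mul_apply]
    simp [reluM, emb_mul_apply]
  · push Not at h
    rw [emb_mul_apply_not _ _ _ h]
    simp [reluM, emb_mul_apply_not _ _ _ h]

/-- A generic feed-forward map. -/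
def gff {ι κ : Type} [Fintype ι] [Fintype κ] {n : ℕ} (W1 : Matrix κ ι ℝ) (W2 : Matrix ι κ ℝ)
    (b1 : κ → ℝ) (z : Matrix ι (Fin n) ℝ) : Matrix ι (Fin n) ℝ :=
  z + W2 * Matrix.of fun k j => max ((W1 * z) k j + b1 k) 0

/-- The all-ones matrix. -/
def onesM (n : ℕ) : Matrix (Fin n) (Fin n) ℝ := Matrix.of fun _ _ => (1 : ℝ)

/-- A generic averaging attention map. -/
def gsa {ι η : Type} [Fintype ι] [Fintype η] {n : ℕ} (A : Matrix η ι ℝ) (B : Matrix ι η ℝ)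
    (z : Matrix ι (Fin n) ℝ) : Matrix ι (Fin n) ℝ :=
  z + B * (A * z * onesM n)

theorem ff_lift {ι κ : Type} [Fintype ι] [DecidableEq ι] [Fintype κ] [DecidableEq κ]
    {n D W : ℕ} (e : ι ↪ Fin D)
    (g : κ ↪ Fin W) (W1 : Matrix κ ι ℝ) (W2 : Matrix ι κ ℝ) (b1 : κ → ℝ) :
    ∃ f, IsFeedForward n D W f ∧ ∀ z, f (emb e * z) = emb e * gff W1 W2 b1 z := by
  refine ⟨_, ⟨emb g * W1 * (emb e)ᵀ, emb e * W2 * (emb g)ᵀ, emb g *ᵥ b1, 0, fun Z => rfl⟩, ?_⟩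
  intro z
  have h1 : emb g * W1 * (emb e)ᵀ * (emb e * z) + (Matrix.of fun i (_ : Fin n) => (emb g *ᵥ b1) i)
      = emb g * (W1 * z + Matrix.of fun k _ => b1 k) := by
    rw [Matrix.mul_add, Matrix.mul_assoc, emb_cancel, Matrix.mul_assoc]
    congr 1
  have h0 : (Matrix.of fun (i : Fin D) (_ : Fin n) => (0 : Fin D → ℝ) i) = 0 := by
    ext; simp
  rw [h1, relu_emb, h0, add_zero, gff, Matrix.mul_add, Matrix.mul_assoc, emb_cancel,
    Matrix.mul_assoc]
  rfl

theorem sa_lift {ι η : Type} [Fintype ι] [DecidableEq ι] [Fintype η] [DecidableEq η]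
    {n D H : ℕ} (hn : 0 < n) (e : ι ↪ Fin D)
    (g : η ↪ Fin H) (A : Matrix η ι ℝ) (B : Matrix ι η ℝ) :
    ∃ f, IsSelfAttn n D H 1 f ∧ ∀ z, f (emb e * z) = emb e * gsa A B z := by
  refine ⟨_, ⟨fun h => Matrix.of fun _ d => (emb g * A * (emb e)ᵀ) h d, 0, 0,
    fun h => Matrix.of fun d _ => n * (emb e * B * (emb g)ᵀ) d h, fun Z => rfl⟩, ?_⟩
  intro z
  have key : emb e * (B * (A * z * onesM n)) =
      (emb e * B * (emb g)ᵀ) * ((emb g * A * (emb e)ᵀ) * (emb e * z) * onesM n) := by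
    simp only [Matrix.mul_assoc, emb_cancel]
  have hn' : (n : ℝ) ≠ 0 := by positivity
  rw [gsa, Matrix.mul_add, key]
  congr 1
  set Y := (emb g * A * (emb e)ᵀ)
  set V := (emb e * B * (emb g)ᵀ)
  ext d j
  simp only [Matrix.sum_apply]
  rw [Matrix.mul_apply]
  refine Finset.sum_congr rfl fun h _ => ?_
  simp [Matrix.mul_apply, softmaxCol, onesM, ← Finset.sum_mul]
  field_simp

theorem foldl_states {α : Type} (L : ℕ) (f : α → Fin L → α) (st : ℕ → α)
    (h : ∀ l : Fin L, f (st l) l = st (l + 1)) : Fin.foldl L f (st 0) = st L := by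
  induction L with
  | zero => simp
  | succ L ih =>
    rw [Fin.foldl_succ_last, ih]
    · exact h (Fin.last L)
    · intro l
      exact h l.castSucc

/-- Generic states. -/
def states {α : Type} (SA FF : ℕ → α → α) (z0 : α) : ℕ → α
  | 0 => z0
  | l + 1 => FF l (SA l (states SA FF z0 l))

theorem transformer_lift {ι : Type} [Fintype ι] [DecidableEq ι] {n dx dy D H W L : ℕ}
    (e : ι ↪ Fin D)
    (SA FF : ℕ → Matrix ι (Fin n) ℝ → Matrix ι (Fin n) ℝ)
    (hSA : ∀ l, ∃ f, IsSelfAttn n D H 1 f ∧ ∀ z, f (emb e * z) = emb e * SA l z)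
    (hFF : ∀ l, ∃ f, IsFeedForward n D W f ∧ ∀ z, f (emb e * z) = emb e * FF l z)
    (Ain : Matrix ι (Fin dx) ℝ) (P : Matrix ι (Fin n) ℝ) (Aout : Matrix (Fin dy) ι ℝ) :
    IsTransformer n dx dy D H 1 W L
      (fun X => Aout * states SA FF (Ain * X + P) L) := by
  choose f hf hf' using hSA
  choose g hg hg' using hFF
  refine ⟨emb e * Ain, emb e * P, Aout * (emb e)ᵀ, fun l => f l, fun l => g l,
    fun l => hf l, fun l => hg l, fun X => ?_⟩
  have := foldl_states L (fun Z (l : Fin L) => g l (f l Z))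
    (fun l => emb e * states SA FF (Ain * X + P) l) (by
      intro l
      simp only [hf', hg', states])
  simp only [states] at this
  rw [Matrix.mul_add, ← Matrix.mul_assoc] at this
  rw [this, Matrix.mul_assoc, emb_cancel]

/-! ### One-dimensional functions -/

/-- Coefficients of the staircase. -/
def cS (w : ℝ) (q : Fin 4) : ℝ := ![0, 1 / w, -(1 / w), 0] q

/-- Coefficients of the bump. -/
def cB (w : ℝ) (q : Fin 4) : ℝ := ![1 / w, -(1 / w), -(1 / w), 1 / w] q

/-- A first-layer neuron. -/
def neur (h w : ℝ) (k : ℕ) (q : Fin 4) (z : ℝ) : ℝ :=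
  max (z + ((1 - (q : ℕ) : ℝ) * w - (k + 1) * h)) 0

/-- The staircase function. -/
def stair (h w : ℝ) (K : ℕ) (z : ℝ) : ℝ := ∑ k : Fin K, ∑ q, cS w q * neur h w k q z

/-- The bump function marking the transition regions. -/
def bump (h w : ℝ) (K : ℕ) (z : ℝ) : ℝ := ∑ k : Fin K, ∑ q, cB w q * neur h w k q z

theorem neur_zero {h w : ℝ} (hw : 0 < w) (hwh : w ≤ h) (k : ℕ) (q : Fin 4) {z : ℝ}
    (hz : z ≤ 0) : neur h w k q z = 0 := by
  unfold neur
  apply max_eq_right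
  have h1 : (0 : ℝ) ≤ ((q : ℕ) : ℝ) * w := by positivity
  have h2 : (0 : ℝ) ≤ k * h := mul_nonneg (by positivity) (by linarith)
  nlinarith

theorem stair_nonpos {h w : ℝ} (hw : 0 < w) (hwh : w ≤ h) (K : ℕ) {z : ℝ}
    (hz : z ≤ 0) : stair h w K z = 0 := by
  simp [stair, neur_zero hw hwh _ _ hz]

theorem bump_nonpos {h w : ℝ} (hw : 0 < w) (hwh : w ≤ h) (K : ℕ) {z : ℝ}
    (hz : z ≤ 0) : bump h w K z = 0 := by
  simp [bump, neur_zero hw hwh _ _ hz]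

theorem stair_term (h w : ℝ) (k : ℕ) (z : ℝ) :
    ∑ q, cS w q * neur h w k q z =
      (max (z - (k + 1) * h) 0 - max (z - (k + 1) * h - w) 0) / w := by
  simp only [Fin.sum_univ_four, cS, neur]
  have e1 : z + ((1 - ((1 : Fin 4) : ℕ) : ℝ) * w - (k + 1) * h) = z - (k + 1) * h := by
    norm_num; ring
  have e2 : z + ((1 - ((2 : Fin 4) : ℕ) : ℝ) * w - (k + 1) * h) = z - (k + 1) * h - w := by
    norm_num; ring
  rw [e1, e2]
  simp
  ring

theorem bump_term (h w : ℝ) (k : ℕ) (z : ℝ) :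
    ∑ q, cB w q * neur h w k q z =
      (max (z - (k + 1) * h + w) 0 - max (z - (k + 1) * h) 0
        - max (z - (k + 1) * h - w) 0 + max (z - (k + 1) * h - 2 * w) 0) / w := by
  simp only [Fin.sum_univ_four, cB, neur]
  have e0 : z + ((1 - ((0 : Fin 4) : ℕ) : ℝ) * w - (k + 1) * h) = z - (k + 1) * h + w := by
    norm_num; ring
  have e1 : z + ((1 - ((1 : Fin 4) : ℕ) : ℝ) * w - (k + 1) * h) = z - (k + 1) * h := by
    norm_num; ring
  have e2 : z + ((1 - ((2 : Fin 4) : ℕ) : ℝ) * w - (k + 1) * h) = z - (k + 1) * h - w := by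
    norm_num; ring
  have e3 : z + ((1 - ((3 : Fin 4) : ℕ) : ℝ) * w - (k + 1) * h) = z - (k + 1) * h - 2 * w := by
    norm_num; ring
  rw [e0, e1, e2, e3]
  simp
  ring

/-- `z` avoids all the (open) transition intervals. -/
def Good (h w : ℝ) (K : ℕ) (z : ℝ) : Prop :=
  ∀ k : Fin K, z ≤ ((k : ℕ) + 1) * h ∨ ((k : ℕ) + 1) * h + w ≤ z

theorem stair_good {h w : ℝ} (hh : 0 < h) (hw : 0 < w) {K : ℕ} {z : ℝ} (hz : 0 ≤ z)
    (hg : Good h w K z) : ∃ p : Fin (K + 1), stair h w K z = (p : ℕ) ∧ ((p : ℕ) : ℝ) * h ≤ z ∧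
      ((p : ℕ) = K ∨ z ≤ ((p : ℕ) + 1) * h) := by
  classical
  have hex : ∃ p : ℕ, p = K ∨ (p < K ∧ z ≤ ((p : ℕ) + 1) * h) := ⟨K, Or.inl rfl⟩
  set p := Nat.find hex with hp
  have hps := Nat.find_spec hex
  rw [← hp] at hps
  have hpK : p ≤ K := by rcases hps with h1 | h1 <;> omega
  have hlt : ∀ k : ℕ, k < p → ((k : ℕ) + 1) * h + w ≤ z := by
    intro k hk
    have := Nat.find_min hex hk
    push Not at this
    have h2 := this.2 (by omega)
    rcases hg ⟨k, by omega⟩ with h3 | h3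
    · exact absurd h3 (not_le.mpr h2)
    · exact h3
  refine ⟨⟨p, by omega⟩, ?_, ?_, ?_⟩
  · unfold stair
    have : ∀ k : Fin K, ∑ q, cS w q * neur h w k q z = if (k : ℕ) < p then 1 else 0 := by
      intro k
      rw [stair_term]
      split_ifs with hk
      · have := hlt k hk
        rw [max_eq_left (by linarith), max_eq_left (by linarith)]
        field_simp
        ring
      · have h1 : z ≤ ((k : ℕ) + 1) * h := by
          rcases hps with h1 | h1
          · omega
          · have : (p : ℝ) ≤ (k : ℕ) := by exact_mod_cast not_lt.mp hk
            nlinarith [h1.2]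
        rw [max_eq_right (by linarith), max_eq_right (by linarith)]
        simp
    rw [Finset.sum_congr rfl fun k _ => this k]
    rw [Fin.sum_univ_eq_sum_range (fun k => if k < p then (1 : ℝ) else 0) K]
    rw [← Finset.sum_filter]
    have : (Finset.range K).filter (fun k => k < p) = Finset.range p := by
      ext k; simp; omega
    rw [this]; simp
  · show (p : ℝ) * h ≤ z
    rcases Nat.eq_zero_or_pos p with h0 | h0
    · rw [h0]; simpa using hz
    · have := hlt (p - 1) (by omega)
      rw [Nat.cast_sub h0] at this
      push_cast at this
      linarith
  · rcases hps with h1 | h1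
    · exact Or.inl h1
    · exact Or.inr h1.2

theorem bump_term_nonneg {h w : ℝ} (hw : 0 < w) (k : ℕ) (z : ℝ) :
    0 ≤ ∑ q, cB w q * neur h w k q z := by
  rw [bump_term]
  apply div_nonneg _ hw.le
  rcases max_cases (z - (k + 1) * h + w) 0 with h1 | h1 <;>
  rcases max_cases (z - (k + 1) * h) 0 with h2 | h2 <;>
  rcases max_cases (z - (k + 1) * h - w) 0 with h3 | h3 <;>
  rcases max_cases (z - (k + 1) * h - 2 * w) 0 with h4 | h4 <;> linarith

theorem bump_nonneg {h w : ℝ} (hw : 0 < w) (K : ℕ) (z : ℝ) : 0 ≤ bump h w K z :=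
  Finset.sum_nonneg fun k _ => bump_term_nonneg hw k z

theorem bump_bad {h w : ℝ} (hw : 0 < w) {K : ℕ} {z : ℝ} (hb : ¬ Good h w K z) :
    1 ≤ bump h w K z := by
  unfold Good at hb
  push Not at hb
  obtain ⟨k, h1, h2⟩ := hb
  refine le_trans ?_ (Finset.single_le_sum (f := fun k : Fin K => ∑ q, cB w q * neur h w k q z)
    (fun k _ => bump_term_nonneg hw (k : ℕ) z) (Finset.mem_univ k))
  rw [bump_term, max_eq_left (by linarith), max_eq_left (by linarith), max_eq_right (by linarith),
    max_eq_right (by linarith)]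
  rw [le_div_iff₀ hw]
  linarith

/-- `z` is within the support of a bump. -/
def Near (h w : ℝ) (K : ℕ) (z : ℝ) : Prop :=
  ∃ k : Fin K, ((k : ℕ) + 1) * h - w < z ∧ z < ((k : ℕ) + 1) * h + 2 * w

theorem bump_far {h w : ℝ} (hw : 0 < w) {K : ℕ} {z : ℝ} (hb : ¬ Near h w K z) :
    bump h w K z = 0 := by
  unfold Near at hb
  push Not at hb
  apply Finset.sum_eq_zero
  intro k _
  rw [bump_term]
  by_cases h1 : ((k : ℕ) + 1) * h - w < z
  · have := hb k h1
    rw [max_eq_left (by linarith), max_eq_left (by linarith), max_eq_left (by linarith),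
      max_eq_left (by linarith)]
    ring
  · rw [max_eq_right (by linarith), max_eq_right (by linarith), max_eq_right (by linarith),
      max_eq_right (by linarith)]
    ring

theorem near_unique {h w : ℝ} {m K : ℕ} (hw : 0 < w) (hwh : 4 * m * w + 3 * w < h)
    {x : ℝ} {s t : ℕ} (hst : s < t) (ht : t ≤ m)
    (h1 : Near h w K (x + s * (4 * w))) (h2 : Near h w K (x + t * (4 * w))) : False := by
  obtain ⟨k, a1, a2⟩ := h1
  obtain ⟨l, b1, b2⟩ := h2
  have e1 : (s : ℝ) + 1 ≤ t := by exact_mod_cast hst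
  have e2 : (t : ℝ) ≤ m := by exact_mod_cast ht
  have e0 : (0 : ℝ) ≤ s := by positivity
  have hm : (0 : ℝ) ≤ m := by positivity
  have hh : 0 < h := by nlinarith
  have f1 : (s + 1 : ℝ) * (4 * w) ≤ t * (4 * w) := by gcongr
  have f2 : (t : ℝ) * (4 * w) ≤ m * (4 * w) := by gcongr
  have f3 : 0 ≤ (s : ℝ) * (4 * w) := by positivity
  rcases le_or_gt (l : ℕ) (k : ℕ) with h3 | h3
  · have h3' : ((l : ℕ) : ℝ) ≤ (k : ℕ) := by exact_mod_cast h3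
    have : (((l : ℕ) : ℝ) + 1) * h ≤ (((k : ℕ) : ℝ) + 1) * h := by gcongr
    linarith
  · have h3' : ((k : ℕ) : ℝ) + 1 ≤ (l : ℕ) := by exact_mod_cast h3
    have : (((k : ℕ) : ℝ) + 1) * h ≤ ((l : ℕ) : ℝ) * h := by gcongr
    linarith

/-- The hat function. -/
def hat (t : ℝ) : ℝ := ∑ q : Fin 3, ![1, -2, 1] q * max (t + (1 - (q : ℕ) : ℝ)) 0

theorem hat_eq (t : ℝ) : hat t = max (t + 1) 0 - 2 * max t 0 + max (t - 1) 0 := by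
  simp [hat, Fin.sum_univ_three]
  norm_num
  ring_nf

theorem hat_bound (t : ℝ) : |hat t| ≤ 1 := by
  rw [hat_eq, abs_le]
  rcases max_cases (t + 1) 0 with h1 | h1 <;>
  rcases max_cases t 0 with h2 | h2 <;>
  rcases max_cases (t - 1) 0 with h3 | h3 <;> constructor <;> linarith

theorem hat_int (p q : ℕ) : hat ((p : ℝ) - q) = if q = p then 1 else 0 := by
  rw [hat_eq]
  split_ifs with h
  · subst h; norm_num
  · rcases lt_or_gt_of_ne h with h1 | h1
    · have : (q : ℝ) + 1 ≤ p := by exact_mod_cast h1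
      rw [max_eq_left (by linarith), max_eq_left (by linarith), max_eq_left (by linarith)]
      ring
    · have : (p : ℝ) + 1 ≤ q := by exact_mod_cast h1
      rw [max_eq_right (by linarith), max_eq_right (by linarith), max_eq_right (by linarith)]
      ring

theorem exists_code (dx n K : ℕ) : ∃ (wt : Fin dx × Fin n → ℕ) (off : Fin n → ℕ),
    Function.Injective (fun (c : Fin n × (Fin dx × Fin n → Fin K)) =>
      off c.1 + ∑ a, wt a * (c.2 a : ℕ)) := by
  refine ⟨fun a => K ^ (finProdFinEquiv a : ℕ), fun j => K ^ (dx * n) * j, ?_⟩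
  have key : ∀ p : Fin dx × Fin n → Fin K,
      ∑ a, K ^ (finProdFinEquiv a : ℕ) * (p a : ℕ) =
        (finFunctionFinEquiv (fun i => p (finProdFinEquiv.symm i)) : ℕ) := by
    intro p
    rw [finFunctionFinEquiv_apply]
    rw [← Equiv.sum_comp finProdFinEquiv]
    refine Finset.sum_congr rfl fun a _ => ?_
    rw [Equiv.symm_apply_apply, mul_comm]
  rintro ⟨j, p⟩ ⟨j', p'⟩ h
  simp only [key] at h
  have h2 : finProdFinEquiv (j, finFunctionFinEquiv (fun i => p (finProdFinEquiv.symm i))) =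
      finProdFinEquiv (j', finFunctionFinEquiv (fun i => p' (finProdFinEquiv.symm i))) := by
    apply Fin.ext
    simp only [finProdFinEquiv_apply_val]
    omega
  have h3 := finProdFinEquiv.injective h2
  simp only [Prod.mk.injEq] at h3
  have h4 := finFunctionFinEquiv.injective h3.2
  refine Prod.ext h3.1 ?_
  funext a
  have := congrFun h4 (finProdFinEquiv a)
  simpa using this

/-! ### The core estimate -/

/-- Representative of a cell. -/
def rep {dx n K : ℕ} (h : ℝ) (p : Fin dx × Fin n → Fin (K + 1)) : Matrix (Fin dx) (Fin n) ℝ :=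
  Matrix.of fun i j => ((p (i, j) : ℕ) : ℝ) * h

/-- The code of a pair (position, cell). -/
def code {dx n K : ℕ} (wt : Fin dx × Fin n → ℕ) (off : Fin n → ℕ)
    (c : Fin n × (Fin dx × Fin n → Fin (K + 1))) : ℕ :=
  off c.1 + ∑ a, wt a * (c.2 a : ℕ)

/-- Table lookup. -/
def table {dx n : ℕ} (K : ℕ) (h : ℝ) (wt : Fin dx × Fin n → ℕ) (off : Fin n → ℕ)
    (F : Matrix (Fin dx) (Fin n) ℝ → Matrix (Fin dx) (Fin n) ℝ) (i : Fin dx) (t : ℝ) : ℝ :=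
  ∑ c : Fin n × (Fin dx × Fin n → Fin (K + 1)),
    F (rep h c.2) i c.1 * hat (t - code wt off c)

/-- The approximant for the shift `s`. -/
def U {dx n : ℕ} (K : ℕ) (h w Mc : ℝ) (wt : Fin dx × Fin n → ℕ) (off : Fin n → ℕ)
    (F : Matrix (Fin dx) (Fin n) ℝ → Matrix (Fin dx) (Fin n) ℝ)
    (X : Matrix (Fin dx) (Fin n) ℝ) (s : ℕ) (i : Fin dx) (j : Fin n) : ℝ :=
  table K h wt off F i (off j + ∑ a : Fin dx × Fin n, wt a * stair h w K (X a.1 a.2 + s * (4 * w)))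
    - Mc * ∑ a : Fin dx × Fin n, bump h w K (X a.1 a.2 + s * (4 * w))

section core

variable {dx n K : ℕ} {h w KH err : ℝ} {wt : Fin dx × Fin n → ℕ} {off : Fin n → ℕ}
  {F : Matrix (Fin dx) (Fin n) ℝ → Matrix (Fin dx) (Fin n) ℝ}

theorem rep_mem (hh : 0 < h) (hK : ((K : ℝ) + 1) * h = 1) (p : Fin dx × Fin n → Fin (K + 1)) :
    rep h p ∈ unitCube dx n := by
  intro i j
  have h1 : ((p (i, j) : ℕ) : ℝ) ≤ K := by exact_mod_cast Nat.lt_succ_iff.mp (p (i, j)).2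
  have h2 : ((p (i, j) : ℕ) : ℝ) * h ≤ K * h := by gcongr
  simp only [rep, Matrix.of_apply, Set.mem_Icc]
  constructor
  · positivity
  · nlinarith

theorem table_bound (hh : 0 < h) (hK : ((K : ℝ) + 1) * h = 1)
    (hb : ∀ Y ∈ unitCube dx n, ∀ i j, |F Y i j| ≤ KH) (i : Fin dx) (t : ℝ) :
    table K h wt off F i t ≤
      Fintype.card (Fin n × (Fin dx × Fin n → Fin (K + 1))) * KH := by
  refine (Finset.sum_le_card_nsmul _ _ KH fun c _ => ?_).trans (by simp [nsmul_eq_mul])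
  refine (le_abs_self _).trans ?_
  rw [abs_mul]
  have h1 := hb _ (rep_mem hh hK c.2) i c.1
  have h2 := hat_bound (t - code wt off c)
  nlinarith [abs_nonneg (F (rep h c.2) i c.1), abs_nonneg (hat (t - code wt off c))]

theorem table_code
    (hinj : Function.Injective (code (K := K) wt off)) (i : Fin dx)
    (c : Fin n × (Fin dx × Fin n → Fin (K + 1))) :
    table K h wt off F i (code wt off c) = F (rep h c.2) i c.1 := by
  unfold table
  rw [Finset.sum_eq_single c]
  · rw [hat_int]; simp
  · intro c' _ hc
    rw [hat_int, if_neg (fun hh => hc (hinj hh)), mul_zero]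
  · simp

theorem good_shift (hh : 0 < h) (hw : 0 < w) (hK : ((K : ℝ) + 1) * h = 1)
    (hwh : 4 * ((dx * n : ℕ) : ℝ) * w + 3 * w < h)
    (hinj : Function.Injective (code (K := K) wt off))
    {X : Matrix (Fin dx) (Fin n) ℝ} (hX : X ∈ unitCube dx n) {s : ℕ} (hs : s ≤ dx * n)
    (hg : ∀ a : Fin dx × Fin n, Good h w K (X a.1 a.2 + s * (4 * w))) :
    ∃ Y ∈ unitCube dx n, (∀ i j, |(X - Y) i j| ≤ h) ∧ ∀ i j,
      table K h wt off F i (off j + ∑ a : Fin dx × Fin n, wt a * stair h w K (X a.1 a.2 + s * (4 * w))) =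
        F Y i j := by
  have hs' : (s : ℝ) ≤ ((dx * n : ℕ) : ℝ) := by exact_mod_cast hs
  have hsw : (s : ℝ) * (4 * w) ≤ ((dx * n : ℕ) : ℝ) * (4 * w) := by gcongr
  have hsw0 : 0 ≤ (s : ℝ) * (4 * w) := by positivity
  have := fun a : Fin dx × Fin n => stair_good hh hw (by have := (hX a.1 a.2).1; linarith) (hg a)
  choose p hp1 hp2 hp3 using this
  refine ⟨rep h p, rep_mem hh hK p, fun i j => ?_, fun i j => ?_⟩
  · simp only [rep, Matrix.sub_apply, Matrix.of_apply]
    have h1 := hp2 (i, j)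
    have h3 := hX i j
    simp only at h1
    rw [abs_le]
    constructor
    · linarith
    · rcases hp3 (i, j) with h4 | h4
      · rw [h4]; linarith [h3.2]
      · simp only at h4; linarith
  · rw [← table_code (h := h) (F := F) hinj i (j, p)]
    congr 1
    simp only [code, hp1]
    push_cast
    rfl

theorem U_upper (hh : 0 < h) (hw : 0 < w) (hK : ((K : ℝ) + 1) * h = 1)
    (hwh : 4 * ((dx * n : ℕ) : ℝ) * w + 3 * w < h)
    (hinj : Function.Injective (code (K := K) wt off)) (hKH : 0 ≤ KH)
    (hb : ∀ Y ∈ unitCube dx n, ∀ i j, |F Y i j| ≤ KH) (herr : 0 ≤ err)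
    {X : Matrix (Fin dx) (Fin n) ℝ} (hX : X ∈ unitCube dx n)
    (hF : ∀ Y ∈ unitCube dx n, (∀ i j, |(X - Y) i j| ≤ h) → ∀ i j, |F X i j - F Y i j| ≤ err)
    {s : ℕ} (hs : s ≤ dx * n) (i : Fin dx) (j : Fin n) :
    U K h w (Fintype.card (Fin n × (Fin dx × Fin n → Fin (K + 1))) * KH + KH) wt off F X s i j
      ≤ F X i j + err := by
  have hM : 0 ≤ (Fintype.card (Fin n × (Fin dx × Fin n → Fin (K + 1))) : ℝ) * KH := by positivity
  unfold U
  by_cases hg : ∀ a : Fin dx × Fin n, Good h w K (X a.1 a.2 + s * (4 * w))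
  · obtain ⟨Y, hY, hd, ht⟩ := good_shift (F := F) hh hw hK hwh hinj hX hs hg
    rw [ht]
    have h1 := (abs_le.mp (hF Y hY hd i j)).1
    have h2 : 0 ≤ ∑ a : Fin dx × Fin n, bump h w K (X a.1 a.2 + s * (4 * w)) :=
      Finset.sum_nonneg fun a _ => bump_nonneg hw K _
    have h3 := mul_nonneg (add_nonneg hM hKH) h2
    linarith
  · push Not at hg
    obtain ⟨a, ha⟩ := hg
    have h2 : 1 ≤ ∑ a : Fin dx × Fin n, bump h w K (X a.1 a.2 + s * (4 * w)) :=
      (bump_bad hw ha).trans (Finset.single_le_sum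
        (f := fun a : Fin dx × Fin n => bump h w K (X a.1 a.2 + s * (4 * w)))
        (fun a _ => bump_nonneg hw K _) (Finset.mem_univ a))
    have h3 := mul_le_mul_of_nonneg_left h2 (add_nonneg hM hKH)
    have h4 := table_bound (wt := wt) (off := off) hh hK hb i
      (off j + ∑ a : Fin dx × Fin n, wt a * stair h w K (X a.1 a.2 + s * (4 * w)))
    have h5 := (abs_le.mp (hb X hX i j)).1
    linarith

theorem U_lower (hh : 0 < h) (hw : 0 < w) (hK : ((K : ℝ) + 1) * h = 1)
    (hwh : 4 * ((dx * n : ℕ) : ℝ) * w + 3 * w < h)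
    (hinj : Function.Injective (code (K := K) wt off)) (Mc : ℝ)
    {X : Matrix (Fin dx) (Fin n) ℝ} (hX : X ∈ unitCube dx n)
    (hF : ∀ Y ∈ unitCube dx n, (∀ i j, |(X - Y) i j| ≤ h) → ∀ i j, |F X i j - F Y i j| ≤ err) :
    ∃ s ≤ dx * n, ∀ i j, F X i j - err ≤ U K h w Mc wt off F X s i j := by
  have hex : ∃ s : Fin (dx * n + 1), ∀ a : Fin dx × Fin n,
      ¬ Near h w K (X a.1 a.2 + (s : ℕ) * (4 * w)) := by
    by_contra hcon
    push Not at hcon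
    choose a ha using hcon
    obtain ⟨s, t, hne, hst⟩ := Fintype.exists_ne_map_eq_of_card_lt a (by simp)
    have hs := ha s
    have ht := ha t
    rw [← hst] at ht
    rcases lt_or_gt_of_ne hne with h1 | h1
    · exact near_unique hw hwh h1 (by omega) hs ht
    · exact near_unique hw hwh h1 (by omega) ht hs
  obtain ⟨s, hs⟩ := hex
  refine ⟨s, by omega, fun i j => ?_⟩
  have hg : ∀ a : Fin dx × Fin n, Good h w K (X a.1 a.2 + (s : ℕ) * (4 * w)) := by
    intro a
    by_contra hb
    have := bump_bad hw hb
    rw [bump_far hw (hs a)] at this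
    linarith
  obtain ⟨Y, hY, hd, ht⟩ := good_shift (F := F) hh hw hK hwh hinj hX (by omega) hg
  unfold U
  rw [ht, Finset.sum_eq_zero fun a _ => bump_far hw (hs a)]
  have h1 := (abs_le.mp (hF Y hY hd i j)).2
  linarith

end core

/-! ### The network -/

theorem gff_apply {ι κ : Type} [Fintype ι] [DecidableEq ι] [Fintype κ] {n : ℕ} (r : κ → ι)
    (W2 : Matrix ι κ ℝ) (b1 : κ → ℝ) (z : Matrix ι (Fin n) ℝ) (c : ι) (j : Fin n) :
    gff (Matrix.of fun k => Pi.single (r k) (1 : ℝ)) W2 b1 z c j =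
      z c j + ∑ k, W2 c k * max (z (r k) j + b1 k) 0 := by
  simp [gff, Matrix.mul_apply, Pi.single_apply]

theorem gsa_apply {ι η : Type} [Fintype ι] [DecidableEq ι] [Fintype η] {n : ℕ} (r : η → ι)
    (B : Matrix ι η ℝ) (z : Matrix ι (Fin n) ℝ) (c : ι) (j : Fin n) :
    gsa (Matrix.of fun k => Pi.single (r k) (1 : ℝ)) B z c j =
      z c j + ∑ k, B c k * ∑ j', z (r k) j' := by
  simp [gsa, Matrix.mul_apply, Pi.single_apply, onesM]

/-- The channels. -/
abbrev Chan (dx n m : ℕ) : Type :=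
  (Fin dx × Fin n) ⊕ (Fin 3 × Fin (m + 1)) ⊕ (Fin (m + 1) × Fin dx)

/-- Input channel. -/
abbrev chI {dx n m : ℕ} (a : Fin dx × Fin n) : Chan dx n m := Sum.inl a

/-- Auxiliary channels. -/
abbrev chA {dx n m : ℕ} (t : Fin 3) (s : Fin (m + 1)) : Chan dx n m := Sum.inr (Sum.inl (t, s))

/-- Value channels. -/
abbrev chU {dx n m : ℕ} (s : Fin (m + 1)) (i : Fin dx) : Chan dx n m := Sum.inr (Sum.inr (s, i))

section net

variable (dx n m K : ℕ) (h w Mc : ℝ) (wt : Fin dx × Fin n → ℕ) (off : Fin n → ℕ)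
  (F : Matrix (Fin dx) (Fin n) ℝ → Matrix (Fin dx) (Fin n) ℝ)

/-- First hidden layer index. -/
abbrev Kap0 : Type := (Fin dx × Fin n) × Fin (m + 1) × Fin K × Fin 4

/-- Second hidden layer index. -/
abbrev Kap1 : Type := Fin (m + 1) × (Fin n × (Fin dx × Fin n → Fin (K + 1))) × Fin 3

/-- First layer output weights. -/
def W20 : Matrix (Chan dx n m) (Kap0 dx n m K) ℝ :=
  Matrix.of fun c k => Sum.elim (fun _ => 0) (Sum.elim (fun ts =>
    if k.2.1 = ts.2 then
      (if ts.1 = 0 then wt k.1 * cS w k.2.2.2 else if ts.1 = 1 then cB w k.2.2.2 else 0) else 0)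
    (fun _ => 0)) c

/-- First layer biases. -/
def b10 (k : Kap0 dx n m K) : ℝ :=
  ((k.2.1 : ℕ) : ℝ) * (4 * w) + ((1 - (k.2.2.2 : ℕ) : ℝ) * w - ((k.2.2.1 : ℕ) + 1) * h)

/-- First feed-forward layer. -/
def FF0 : Matrix (Chan dx n m) (Fin n) ℝ → Matrix (Chan dx n m) (Fin n) ℝ :=
  gff (Matrix.of fun k : Kap0 dx n m K => Pi.single (chI k.1) (1 : ℝ)) (W20 dx n m K w wt)
    (b10 dx n m K h w)

/-- Second layer output weights. -/
def W21 : Matrix (Chan dx n m) (Kap1 dx n m K) ℝ :=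
  Matrix.of fun c k => Sum.elim (fun _ => 0) (Sum.elim (fun _ => 0) (fun si =>
    if k.1 = si.1 then F (rep h k.2.1.2) si.2 k.2.1.1 * ![1, -2, 1] k.2.2 else 0)) c

/-- Second layer biases. -/
def b11 (k : Kap1 dx n m K) : ℝ := - (code wt off k.2.1 : ℝ) + (1 - (k.2.2 : ℕ) : ℝ)

/-- Second feed-forward layer. -/
def FF1 : Matrix (Chan dx n m) (Fin n) ℝ → Matrix (Chan dx n m) (Fin n) ℝ :=
  gff (Matrix.of fun k : Kap1 dx n m K => Pi.single (chA 2 k.1) (1 : ℝ)) (W21 dx n m K h F)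
    (b11 dx n m K wt off)

/-- Maximum layer. -/
def FF2 (s : Fin (m + 1)) : Matrix (Chan dx n m) (Fin n) ℝ → Matrix (Chan dx n m) (Fin n) ℝ :=
  gff (Matrix.of fun k : Fin dx => Pi.single (chU s k) (1 : ℝ) - Pi.single (chU 0 k) (1 : ℝ))
    (Matrix.of fun c k => if c = chU 0 k then 1 else 0) 0

/-- Attention layer summing the codes. -/
def SA1 : Matrix (Chan dx n m) (Fin n) ℝ → Matrix (Chan dx n m) (Fin n) ℝ :=
  gsa (Matrix.of fun k : Fin (m + 1) => Pi.single (chA 0 k) (1 : ℝ))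
    (Matrix.of fun c k => if c = chA 2 k then 1 else 0)

/-- Attention layer summing the penalties. -/
def SA2 : Matrix (Chan dx n m) (Fin n) ℝ → Matrix (Chan dx n m) (Fin n) ℝ :=
  gsa (Matrix.of fun k : Fin (m + 1) => Pi.single (chA 1 k) (1 : ℝ))
    (Matrix.of fun c k => Sum.elim (fun _ => 0) (Sum.elim (fun _ => 0)
      (fun si => if k = si.1 then -Mc else 0)) c)

/-- Trivial attention layer. -/
def SAz : Matrix (Chan dx n m) (Fin n) ℝ → Matrix (Chan dx n m) (Fin n) ℝ :=
  gsa (η := Fin (m + 1)) 0 0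

/-- All feed-forward layers. -/
def FFs : ℕ → Matrix (Chan dx n m) (Fin n) ℝ → Matrix (Chan dx n m) (Fin n) ℝ
  | 0 => FF0 dx n m K h w wt
  | 1 => FF1 dx n m K h wt off F
  | l + 2 => FF2 dx n m (Fin.ofNat (m + 1) l)

/-- All attention layers. -/
def SAs : ℕ → Matrix (Chan dx n m) (Fin n) ℝ → Matrix (Chan dx n m) (Fin n) ℝ
  | 0 => SAz dx n m
  | 1 => SA1 dx n m
  | 2 => SA2 dx n m Mc
  | _ + 3 => SAz dx n m

/-- Input weights. -/
def Ain : Matrix (Chan dx n m) (Fin dx) ℝ :=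
  Matrix.of fun c => Sum.elim (fun a => Pi.single a.1 1) (fun _ => 0) c

/-- Positional encoding. -/
def Pin : Matrix (Chan dx n m) (Fin n) ℝ :=
  Matrix.of fun c j => Sum.elim (fun a => if a.2 = j then 0 else -2)
    (Sum.elim (fun ts => if ts.1 = 2 then (off j : ℝ) else 0) (fun _ => 0)) c

/-- Output weights. -/
def Aout : Matrix (Fin dx) (Chan dx n m) ℝ :=
  Matrix.of fun i => Pi.single (chU 0 i) 1

/-- The states. -/
def st (X : Matrix (Fin dx) (Fin n) ℝ) : ℕ → Matrix (Chan dx n m) (Fin n) ℝ :=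
  states (SAs dx n m Mc) (FFs dx n m K h w wt off F) (Ain dx n m * X + Pin dx n m off)

variable {dx n m K h w Mc wt off F}

theorem SAz_eq (z : Matrix (Chan dx n m) (Fin n) ℝ) : SAz dx n m z = z := by
  simp [SAz, gsa]

theorem z0_I (X : Matrix (Fin dx) (Fin n) ℝ) (a : Fin dx × Fin n) (j : Fin n) :
    (Ain dx n m * X + Pin dx n m off) (chI a) j = X a.1 j + if a.2 = j then 0 else -2 := by
  simp [Ain, Pin, Matrix.mul_apply, Pi.single_apply]

theorem z0_A (X : Matrix (Fin dx) (Fin n) ℝ) (t : Fin 3) (s : Fin (m + 1)) (j : Fin n) :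
    (Ain dx n m * X + Pin dx n m off) (chA t s) j = if t = 2 then (off j : ℝ) else 0 := by
  simp [Ain, Pin, Matrix.mul_apply]

theorem z0_U (X : Matrix (Fin dx) (Fin n) ℝ) (s : Fin (m + 1)) (i : Fin dx) (j : Fin n) :
    (Ain dx n m * X + Pin dx n m off) (chU s i) j = 0 := by
  simp [Ain, Pin, Matrix.mul_apply]

theorem FF0_0 (z : Matrix (Chan dx n m) (Fin n) ℝ) (s : Fin (m + 1)) (j : Fin n) :
    FF0 dx n m K h w wt z (chA 0 s) j =
      z (chA 0 s) j + ∑ a, wt a * stair h w K (z (chI a) j + (s : ℕ) * (4 * w)) := by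
  rw [FF0, gff_apply, Fintype.sum_prod_type]
  congr 1
  refine Finset.sum_congr rfl fun a _ => ?_
  rw [Fintype.sum_prod_type, Finset.sum_eq_single s]
  · rw [Fintype.sum_prod_type, stair, Finset.mul_sum]
    refine Finset.sum_congr rfl fun k _ => ?_
    rw [Finset.mul_sum]
    refine Finset.sum_congr rfl fun q _ => ?_
    simp only [W20, b10, neur, Matrix.of_apply, Sum.elim_inr, Sum.elim_inl, if_true, mul_assoc,
      add_assoc]
  · intro s' _ hs'
    exact Finset.sum_eq_zero fun k _ => by simp [W20, hs']
  · simp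

theorem FF0_1 (z : Matrix (Chan dx n m) (Fin n) ℝ) (s : Fin (m + 1)) (j : Fin n) :
    FF0 dx n m K h w wt z (chA 1 s) j =
      z (chA 1 s) j + ∑ a, bump h w K (z (chI a) j + (s : ℕ) * (4 * w)) := by
  rw [FF0, gff_apply, Fintype.sum_prod_type]
  congr 1
  refine Finset.sum_congr rfl fun a _ => ?_
  rw [Fintype.sum_prod_type, Finset.sum_eq_single s]
  · rw [Fintype.sum_prod_type, bump]
    refine Finset.sum_congr rfl fun k _ => ?_
    refine Finset.sum_congr rfl fun q _ => ?_
    simp [W20, b10, neur, add_assoc]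
  · intro s' _ hs'
    exact Finset.sum_eq_zero fun k _ => by simp [W20, hs']
  · simp

theorem FF0_2 (z : Matrix (Chan dx n m) (Fin n) ℝ) (s : Fin (m + 1)) (j : Fin n) :
    FF0 dx n m K h w wt z (chA 2 s) j = z (chA 2 s) j := by
  rw [FF0, gff_apply, Finset.sum_eq_zero, add_zero]
  intro k _
  simp [W20]

theorem FF0_U (z : Matrix (Chan dx n m) (Fin n) ℝ) (s : Fin (m + 1)) (i : Fin dx) (j : Fin n) :
    FF0 dx n m K h w wt z (chU s i) j = z (chU s i) j := by
  rw [FF0, gff_apply, Finset.sum_eq_zero, add_zero]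
  intro k _
  simp [W20]

theorem SA1_2 (z : Matrix (Chan dx n m) (Fin n) ℝ) (s : Fin (m + 1)) (j : Fin n) :
    SA1 dx n m z (chA 2 s) j = z (chA 2 s) j + ∑ j', z (chA 0 s) j' := by
  rw [SA1, gsa_apply]
  simp

theorem SA1_1 (z : Matrix (Chan dx n m) (Fin n) ℝ) (s : Fin (m + 1)) (j : Fin n) :
    SA1 dx n m z (chA 1 s) j = z (chA 1 s) j := by
  rw [SA1, gsa_apply]
  simp

theorem SA1_U (z : Matrix (Chan dx n m) (Fin n) ℝ) (s : Fin (m + 1)) (i : Fin dx) (j : Fin n) :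
    SA1 dx n m z (chU s i) j = z (chU s i) j := by
  rw [SA1, gsa_apply]
  simp

theorem FF1_1 (z : Matrix (Chan dx n m) (Fin n) ℝ) (t : Fin 3) (s : Fin (m + 1)) (j : Fin n) :
    FF1 dx n m K h wt off F z (chA t s) j = z (chA t s) j := by
  rw [FF1, gff_apply, Finset.sum_eq_zero, add_zero]
  intro k _
  simp [W21]

theorem FF1_U (z : Matrix (Chan dx n m) (Fin n) ℝ) (s : Fin (m + 1)) (i : Fin dx) (j : Fin n) :
    FF1 dx n m K h wt off F z (chU s i) j =
      z (chU s i) j + table K h wt off F i (z (chA 2 s) j) := by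
  rw [FF1, gff_apply, Fintype.sum_prod_type]
  congr 1
  rw [Finset.sum_eq_single s]
  · rw [Fintype.sum_prod_type, table]
    refine Finset.sum_congr rfl fun c _ => ?_
    rw [hat, Finset.mul_sum]
    refine Finset.sum_congr rfl fun q _ => ?_
    simp only [W21, b11, Matrix.of_apply, Sum.elim_inr, if_true, mul_assoc, sub_eq_add_neg,
      add_assoc]
  · intro s' _ hs'
    exact Finset.sum_eq_zero fun k _ => by simp [W21, hs']
  · simp

theorem SA2_U (z : Matrix (Chan dx n m) (Fin n) ℝ) (s : Fin (m + 1)) (i : Fin dx) (j : Fin n) :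
    SA2 dx n m Mc z (chU s i) j = z (chU s i) j - Mc * ∑ j', z (chA 1 s) j' := by
  rw [SA2, gsa_apply]
  simp [sub_eq_add_neg]

theorem FF2_U (t s : Fin (m + 1)) (z : Matrix (Chan dx n m) (Fin n) ℝ) (i : Fin dx) (j : Fin n) :
    FF2 dx n m t z (chU s i) j =
      if s = 0 then max (z (chU t i) j) (z (chU 0 i) j) else z (chU s i) j := by
  have : FF2 dx n m t z (chU s i) j = z (chU s i) j +
      if s = 0 then max (z (chU t i) j - z (chU 0 i) j) 0 else 0 := by
    simp only [FF2, gff, Matrix.add_apply, Matrix.mul_apply, Matrix.of_apply, Pi.sub_apply,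
      sub_mul, Finset.sum_sub_distrib, Pi.single_apply]
    split_ifs with hs
    · subst hs
      simp
    · simp [hs]
  rw [this]
  split_ifs with hs
  · subst hs
    rw [← max_add_add_left]
    simp
  · simp

theorem gate_sum (f : ℝ → ℝ) (hf : ∀ z ≤ 0, f z = 0) {s : ℝ} (hX0 : (s : ℝ) ≤ 1)
    {X : Matrix (Fin dx) (Fin n) ℝ} (hX : X ∈ unitCube dx n) (a : Fin dx × Fin n) :
    ∑ j', f (X a.1 j' + (if a.2 = j' then 0 else -2) + s) = f (X a.1 a.2 + s) := by
  rw [Finset.sum_eq_single a.2]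
  · simp
  · intro j _ hj
    apply hf
    rw [if_neg (Ne.symm hj)]
    have := (hX a.1 j).2
    linarith
  · simp

/-- State after the penalties have been added. -/
theorem st3_U (hw : 0 < w) (hwh : w ≤ h) (hmw : (m : ℝ) * (4 * w) ≤ 1)
    {X : Matrix (Fin dx) (Fin n) ℝ} (hX : X ∈ unitCube dx n) (s : Fin (m + 1)) (i : Fin dx)
    (j : Fin n) :
    st dx n m K h w Mc wt off F X 3 (chU s i) j = U K h w Mc wt off F X s i j := by
  have hs1 : ∀ s : Fin (m + 1), ((s : ℕ) : ℝ) * (4 * w) ≤ 1 := by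
    intro s
    refine le_trans ?_ hmw
    have : ((s : ℕ) : ℝ) ≤ m := by exact_mod_cast Nat.lt_succ_iff.mp s.2
    gcongr
  have key : ∀ s : Fin (m + 1), SA2 dx n m Mc (st dx n m K h w Mc wt off F X 2) (chU s i) j =
      U K h w Mc wt off F X s i j := by
    intro s
    rw [SA2_U]
    simp only [st, states, SAs, FFs, FF1_U, FF1_1, SA1_1, SA1_2, SA1_U, FF0_0, FF0_1, FF0_2, FF0_U,
      SAz_eq, z0_I, z0_A, z0_U]
    simp only [U]
    have e1 : ∑ j', ∑ a : Fin dx × Fin n,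
        (wt a : ℝ) * stair h w K (X a.1 j' + (if a.2 = j' then 0 else -2) + (s : ℕ) * (4 * w)) =
        ∑ a : Fin dx × Fin n, (wt a : ℝ) * stair h w K (X a.1 a.2 + (s : ℕ) * (4 * w)) := by
      rw [Finset.sum_comm]
      refine Finset.sum_congr rfl fun a _ => ?_
      exact gate_sum (fun z => (wt a : ℝ) * stair h w K z)
        (fun z hz => by simp only [stair_nonpos hw hwh K hz, mul_zero]) (hs1 s) hX a
    have e2 : ∑ j', ∑ a : Fin dx × Fin n,
        bump h w K (X a.1 j' + (if a.2 = j' then 0 else -2) + (s : ℕ) * (4 * w)) =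
        ∑ a : Fin dx × Fin n, bump h w K (X a.1 a.2 + (s : ℕ) * (4 * w)) := by
      rw [Finset.sum_comm]
      refine Finset.sum_congr rfl fun a _ => ?_
      exact gate_sum (fun z => bump h w K z)
        (fun z hz => bump_nonpos hw hwh K hz) (hs1 s) hX a
    have d0 : ¬ ((0 : Fin 3) = 2) := by decide
    have d1 : ¬ ((1 : Fin 3) = 2) := by decide
    simp only [if_neg d0, if_neg d1, if_true, zero_add, e1, e2]
  show FF2 dx n m (Fin.ofNat (m + 1) 0) (SA2 dx n m Mc (st dx n m K h w Mc wt off F X 2))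
    (chU s i) j = _
  rw [FF2_U, ← key]
  have : (Fin.ofNat (m + 1) 0) = 0 := rfl
  rw [this]
  split_ifs with h0
  · subst h0; simp
  · rfl

theorem st_succ (X : Matrix (Fin dx) (Fin n) ℝ) (l : ℕ) (s : Fin (m + 1)) (i : Fin dx)
    (j : Fin n) :
    st dx n m K h w Mc wt off F X (3 + l + 1) (chU s i) j =
      if s = 0 then max (st dx n m K h w Mc wt off F X (3 + l) (chU (Fin.ofNat (m + 1) (l + 1)) i) j)
        (st dx n m K h w Mc wt off F X (3 + l) (chU 0 i) j)
      else st dx n m K h w Mc wt off F X (3 + l) (chU s i) j := by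
  rw [← FF2_U]
  rw [show 3 + l + 1 = (l + 3) + 1 by ring, show 3 + l = l + 3 by ring]
  simp only [st]
  rw [states]
  simp only [SAs, SAz_eq, FFs]

theorem st_inv (X : Matrix (Fin dx) (Fin n) ℝ) (i : Fin dx) (j : Fin n)
    (u : Fin (m + 1) → ℝ) (hu : ∀ s, st dx n m K h w Mc wt off F X 3 (chU s i) j = u s) (l : ℕ) :
    (∀ s ≠ 0, st dx n m K h w Mc wt off F X (3 + l) (chU s i) j = u s) ∧
    (∀ s : Fin (m + 1), (s : ℕ) ≤ l → u s ≤ st dx n m K h w Mc wt off F X (3 + l) (chU 0 i) j) ∧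
    (∀ b, (∀ s, u s ≤ b) → st dx n m K h w Mc wt off F X (3 + l) (chU 0 i) j ≤ b) := by
  induction l with
  | zero =>
    refine ⟨fun s _ => hu s, fun s hs => ?_, fun b hb => ?_⟩
    · have : s = 0 := by apply Fin.ext; simpa using hs
      subst this
      exact (hu 0).ge
    · exact (hu 0).trans_le (hb 0)
  | succ l ih =>
    obtain ⟨h1, h2, h3⟩ := ih
    simp only [← add_assoc, st_succ]
    refine ⟨fun s hs => ?_, fun s hs => ?_, fun b hb => ?_⟩
    · rw [if_neg hs, h1 s hs]
    · rw [if_pos trivial]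
      rcases Nat.lt_or_ge l s with h4 | h4
      · have h5 : (Fin.ofNat (m + 1) (l + 1)) = s := by
          apply Fin.ext
          simp only [Fin.ofNat]
          rw [Nat.mod_eq_of_lt (by omega)]
          omega
        rw [h5]
        refine le_max_of_le_left (h1 s ?_).ge
        intro h0
        rw [h0] at h4
        simp at h4
      · exact le_max_of_le_right (h2 s h4)
    · rw [if_pos trivial]
      refine max_le ?_ (h3 b hb)
      by_cases h0 : (Fin.ofNat (m + 1) (l + 1)) = 0
      · rw [h0]; exact h3 b hb
      · rw [h1 _ h0]; exact hb _

end net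

/-! ### Final assembly -/

theorem frob_le {dx n : ℕ} (A : Matrix (Fin dx) (Fin n) ℝ) {c : ℝ} (hc : 0 ≤ c)
    (hA : ∀ i j, |A i j| ≤ c) : frobNorm A ≤ √((dx : ℝ) * n) * c := by
  unfold frobNorm
  rw [Real.sqrt_le_left (by positivity), mul_pow, Real.sq_sqrt (by positivity)]
  have : ∀ i j, (A i j) ^ 2 ≤ c ^ 2 := fun i j => by
    rw [← sq_abs]
    exact pow_le_pow_left₀ (abs_nonneg _) (hA i j) 2
  calc ∑ i, ∑ j, (A i j) ^ 2 ≤ ∑ _i : Fin dx, ∑ _j : Fin n, c ^ 2 :=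
        Finset.sum_le_sum fun i _ => Finset.sum_le_sum fun j _ => this i j
    _ = _ := by simp; ring

theorem three_pow_bound (m : ℕ) : 4 * m * (m + 1) ≤ 5 * 3 ^ m ∧ m + 1 ≤ 3 ^ m := by
  induction m with
  | zero => simp
  | succ m ih =>
    obtain ⟨h1, h2⟩ := ih
    rw [pow_succ]
    refine ⟨?_, by omega⟩
    rcases Nat.eq_zero_or_pos m with h0 | h0
    · subst h0; simp
    · rcases Nat.lt_or_ge m 2 with h3 | h3
      · have : m = 1 := by omega
        subst this; norm_num
      · nlinarith

theorem net_isTransformer {dx n : ℕ} (hdx : 0 < dx) (hn : 0 < n) (K Nc : ℕ)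
    (hNc : (K + 1) ^ (dx * n) ≤ Nc) (h w Mc : ℝ) (wt : Fin dx × Fin n → ℕ) (off : Fin n → ℕ)
    (F : Matrix (Fin dx) (Fin n) ℝ → Matrix (Fin dx) (Fin n) ℝ) (L : ℕ) :
    IsTransformer n dx dx (5 * dx * 3 ^ (dx * n)) (3 ^ (dx * n)) 1
        (5 * n * 3 ^ (dx * n) * Nc) L
      (fun X => Aout dx n (dx * n) * st dx n (dx * n) K h w Mc wt off F X L) := by
  classical
  set m := dx * n with hm
  obtain ⟨hb1, hb2⟩ := three_pow_bound m
  have hm0 : 0 < m := Nat.mul_pos hdx hn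
  have hK1 : K + 1 ≤ Nc := le_trans (by
    calc K + 1 = (K + 1) ^ 1 := (pow_one _).symm
      _ ≤ (K + 1) ^ m := Nat.pow_le_pow_right (by omega) hm0) hNc
  have hdm : dx ≤ m := Nat.le_mul_of_pos_right dx hn
  have e0 : Nonempty (Chan dx n m ↪ Fin (5 * dx * 3 ^ m)) := by
    apply Function.Embedding.nonempty_of_card_le
    simp only [Fintype.card_sum, Fintype.card_prod, Fintype.card_fin, ← hm]
    have : (m + 1) * dx ≤ 3 ^ m * dx := Nat.mul_le_mul_right _ hb2
    have : 1 * 3 ^ m ≤ dx * 3 ^ m := Nat.mul_le_mul_right _ hdx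
    nlinarith
  have eH : Nonempty (Fin (m + 1) ↪ Fin (3 ^ m)) := by
    apply Function.Embedding.nonempty_of_card_le
    simpa using hb2
  have eK0 : Nonempty (Kap0 dx n m K ↪ Fin (5 * n * 3 ^ m * Nc)) := by
    apply Function.Embedding.nonempty_of_card_le
    simp only [Fintype.card_prod, Fintype.card_fin, ← hm]
    calc m * ((m + 1) * (K * 4)) = (4 * m * (m + 1)) * K := by ring
      _ ≤ (5 * 3 ^ m) * Nc := Nat.mul_le_mul hb1 (by omega)
      _ ≤ n * ((5 * 3 ^ m) * Nc) := Nat.le_mul_of_pos_left _ hn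
      _ = _ := by ring
  have eK1 : Nonempty (Kap1 dx n m K ↪ Fin (5 * n * 3 ^ m * Nc)) := by
    apply Function.Embedding.nonempty_of_card_le
    simp only [Fintype.card_prod, Fintype.card_fin, Fintype.card_fun, ← hm]
    calc (m + 1) * (n * (K + 1) ^ m * 3) ≤ 3 ^ m * (n * Nc * 3) := by gcongr
      _ = 3 * (n * 3 ^ m * Nc) := by ring
      _ ≤ 5 * (n * 3 ^ m * Nc) := by gcongr; norm_num
      _ = _ := by ring
  have eK2 : Nonempty (Fin dx ↪ Fin (5 * n * 3 ^ m * Nc)) := by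
    apply Function.Embedding.nonempty_of_card_le
    simp only [Fintype.card_fin]
    calc dx ≤ 3 ^ m := by omega
      _ ≤ 3 ^ m * (5 * n * Nc) := Nat.le_mul_of_pos_right _ (by
        have : 0 < Nc := by omega
        positivity)
      _ = _ := by ring
  obtain ⟨e⟩ := e0
  obtain ⟨gH⟩ := eH
  obtain ⟨g0⟩ := eK0
  obtain ⟨g1⟩ := eK1
  obtain ⟨g2⟩ := eK2
  refine transformer_lift e (SAs dx n m Mc) (FFs dx n m K h w wt off F) ?_ ?_ (Ain dx n m)
    (Pin dx n m off) (Aout dx n m)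
  · intro l
    match l with
    | 0 => exact sa_lift hn e gH _ _
    | 1 => exact sa_lift hn e gH _ _
    | 2 => exact sa_lift hn e gH _ _
    | _ + 3 => exact sa_lift hn e gH _ _
  · intro l
    match l with
    | 0 => exact ff_lift e g0 _ _ _
    | 1 => exact ff_lift e g1 _ _ _
    | _ + 2 => exact ff_lift e g2 _ _ _

theorem net_error {dx n : ℕ} (hdx : 0 < dx) (hn : 0 < n) (K : ℕ) {h w KH err : ℝ}
    (hh : 0 < h) (hw : 0 < w) (hK : ((K : ℝ) + 1) * h = 1)
    (hwh : 4 * ((dx * n : ℕ) : ℝ) * w + 3 * w < h) {wt : Fin dx × Fin n → ℕ} {off : Fin n → ℕ}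
    (hinj : Function.Injective (code (K := K) wt off)) (hKH : 0 ≤ KH)
    {F : Matrix (Fin dx) (Fin n) ℝ → Matrix (Fin dx) (Fin n) ℝ}
    (hb : ∀ Y ∈ unitCube dx n, ∀ i j, |F Y i j| ≤ KH) (herr : 0 ≤ err)
    {X : Matrix (Fin dx) (Fin n) ℝ} (hX : X ∈ unitCube dx n)
    (hF : ∀ Y ∈ unitCube dx n, (∀ i j, |(X - Y) i j| ≤ h) → ∀ i j, |F X i j - F Y i j| ≤ err)
    (i : Fin dx) (j : Fin n) :
    |(Aout dx n (dx * n) * st dx n (dx * n) K h w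
      (Fintype.card (Fin n × (Fin dx × Fin n → Fin (K + 1))) * KH + KH) wt off F X
        (2 + 2 * dx * n) - F X) i j| ≤ err := by
  have hm0 : 0 < dx * n := Nat.mul_pos hdx hn
  have hh1 : h ≤ 1 := by nlinarith [(Nat.cast_nonneg K : (0 : ℝ) ≤ K)]
  have hmw : ((dx * n : ℕ) : ℝ) * (4 * w) ≤ 1 := by nlinarith
  have hwh' : w ≤ h := by
    have : 0 ≤ 4 * ((dx * n : ℕ) : ℝ) * w := by positivity
    linarith
  set Mc : ℝ := (Fintype.card (Fin n × (Fin dx × Fin n → Fin (K + 1))) * KH + KH) with hMc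
  have hout : ∀ l, (Aout dx n (dx * n) * st dx n (dx * n) K h w Mc wt off F X l) i j =
      st dx n (dx * n) K h w Mc wt off F X l (chU 0 i) j := by
    intro l
    simp [Aout, Matrix.mul_apply, Pi.single_apply]
  have hL : 2 + 2 * dx * n = 3 + (2 * (dx * n) - 1) := by
    rw [mul_assoc]; omega
  obtain ⟨-, i2, i3⟩ := st_inv X i j (fun s => U K h w Mc wt off F X s i j)
    (fun s => st3_U hw hwh' hmw hX s i j) (2 * (dx * n) - 1)
  rw [Matrix.sub_apply, hout, hL, abs_le]
  constructor
  · obtain ⟨s, hs, hU⟩ := U_lower (F := F) hh hw hK hwh hinj Mc hX hF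
    have := i2 ⟨s, by omega⟩ (by simp only; omega)
    have := hU i j
    simp only at *
    linarith
  · have := i3 (F X i j + err) fun s => U_upper hh hw hK hwh hinj hKH hb herr hX hF (by omega) i j
    linarith

end

end TransApprox

/-- Theorem 4, case `p = ∞`: uniform approximation of entrywise `γ`-Hölder
sequence-to-sequence functions by transformers on the unit cube. -/
theorem transformer_holder_approx_sup
    (dx n : ℕ) (hdx : 0 < dx) (hn : 0 < n) (γ KH ε : ℝ)
    (hγ : γ ∈ Set.Ioc (0 : ℝ) 1) (hKH : 0 < KH) (hε : ε ∈ Set.Ioo (0 : ℝ) 1)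
    (F : Matrix (Fin dx) (Fin n) ℝ → Matrix (Fin dx) (Fin n) ℝ)
    (hF : ∀ i j, HolderClass γ KH (unitCube dx n) (fun X => F X i j)) :
    ∃ N : Matrix (Fin dx) (Fin n) ℝ → Matrix (Fin dx) (Fin n) ℝ,
      IsTransformer n dx dx (5 * dx * 3 ^ (dx * n)) (3 ^ (dx * n)) 1
        (5 * n * 3 ^ (dx * n) * ⌈ε ^ (-((dx : ℝ) * n) / γ)⌉₊) (2 + 2 * dx * n) N ∧
      ∀ X ∈ unitCube dx n, frobNorm (N X - F X) ≤ 4 * ((dx : ℝ) * n) ^ 2 * KH * ε := by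
  obtain ⟨hγ0, hγ1⟩ := hγ
  obtain ⟨hε0, hε1⟩ := hε
  set t : ℝ := ε ^ (-1 / γ) with ht
  have ht1 : 1 ≤ t := by
    apply Real.one_le_rpow_of_pos_of_le_one_of_nonpos hε0 hε1.le
    rw [neg_div, Left.neg_nonpos_iff]
    positivity
  have hfl : 1 ≤ ⌊t⌋₊ := (Nat.one_le_floor_iff t).mpr ht1
  obtain ⟨K, hK⟩ : ∃ K, ⌊t⌋₊ = K + 1 := ⟨⌊t⌋₊ - 1, by omega⟩
  have hKt : ((K : ℝ) + 1) ≤ t := by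
    have := Nat.floor_le (zero_le_one.trans ht1)
    rw [hK] at this
    exact_mod_cast this
  have htK : t < ((K : ℝ) + 1) + 1 := by
    have := Nat.lt_floor_add_one t
    rw [hK] at this
    exact_mod_cast this
  have hK0 : (0 : ℝ) ≤ K := Nat.cast_nonneg K
  have hNc : (K + 1) ^ (dx * n) ≤ ⌈ε ^ (-((dx : ℝ) * n) / γ)⌉₊ := by
    have h1 : ((K : ℝ) + 1) ^ (dx * n) ≤ ε ^ (-((dx : ℝ) * n) / γ) := by
      calc ((K : ℝ) + 1) ^ (dx * n) ≤ t ^ (dx * n) := by gcongr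
        _ = _ := by
          rw [ht, ← Real.rpow_mul_natCast hε0.le]
          congr 1
          push_cast
          ring
    have h2 := h1.trans (Nat.le_ceil _)
    exact_mod_cast h2
  set h : ℝ := 1 / ((K : ℝ) + 1) with hh
  have hh0 : 0 < h := by positivity
  have hKh : ((K : ℝ) + 1) * h = 1 := by rw [hh]; field_simp
  have hm1 : (1 : ℝ) ≤ ((dx * n : ℕ) : ℝ) := by exact_mod_cast Nat.mul_pos hdx hn
  set w : ℝ := h / (8 * ((dx * n : ℕ) : ℝ)) with hwdef
  have hw0 : 0 < w := by positivity
  have hwm : w * (8 * ((dx * n : ℕ) : ℝ)) = h := by rw [hwdef]; field_simp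
  have hwh : 4 * ((dx * n : ℕ) : ℝ) * w + 3 * w < h := by nlinarith
  obtain ⟨wt, off, hinj⟩ := TransApprox.exists_code dx n (K + 1)
  have hbd : ∀ Y ∈ unitCube dx n, ∀ i j, |F Y i j| ≤ KH := by
    intro Y hY i j
    obtain ⟨C1, C2, h1, h2, h3, h4, -⟩ := hF i j
    have := h4 Y hY
    simp only at this
    linarith
  have hmm : ((dx * n : ℕ) : ℝ) = (dx : ℝ) * n := by push_cast; rfl
  rw [hmm] at hm1
  have hsq1 : 1 ≤ √((dx : ℝ) * n) := Real.one_le_sqrt.mpr hm1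
  set err : ℝ := KH * (2 * √((dx : ℝ) * n) * ε) with herr
  have herr0 : 0 ≤ err := by positivity
  have hht : h ≤ 2 * ε ^ (1 / γ) := by
    have h1 : ε ^ (1 / γ) * t = 1 := by
      rw [ht, ← Real.rpow_add hε0]
      rw [show 1 / γ + -1 / γ = 0 by ring, Real.rpow_zero]
    have h2 : 0 < ε ^ (1 / γ) := by positivity
    rw [hh, div_le_iff₀ (by positivity)]
    nlinarith
  have hmod : ∀ X ∈ unitCube dx n, ∀ Y ∈ unitCube dx n, (∀ i j, |(X - Y) i j| ≤ h) →
      ∀ i j, |F X i j - F Y i j| ≤ err := by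
    intro X hX Y hY hXY i j
    obtain ⟨C1, C2, h1, h2, h3, -, h5⟩ := hF i j
    have h6 := h5 X hX Y hY
    simp only at h6
    have h7 := TransApprox.frob_le (X - Y) hh0.le hXY
    have h8 : frobNorm (X - Y) ^ γ ≤ 2 * √((dx : ℝ) * n) * ε := by
      calc frobNorm (X - Y) ^ γ ≤ ((2 * √((dx : ℝ) * n)) * ε ^ (1 / γ)) ^ γ := by
            apply Real.rpow_le_rpow (Real.sqrt_nonneg _) _ hγ0.le
            refine h7.trans ?_
            nlinarith
        _ = (2 * √((dx : ℝ) * n)) ^ γ * ε := by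
            rw [Real.mul_rpow (by positivity) (by positivity), ← Real.rpow_mul hε0.le,
              one_div_mul_cancel hγ0.ne', Real.rpow_one]
        _ ≤ _ := by
            gcongr
            calc (2 * √((dx : ℝ) * n)) ^ γ ≤ (2 * √((dx : ℝ) * n)) ^ (1 : ℝ) :=
                  Real.rpow_le_rpow_of_exponent_le (by linarith) hγ1
              _ = _ := Real.rpow_one _
    have h9 : 0 ≤ frobNorm (X - Y) ^ γ := Real.rpow_nonneg (Real.sqrt_nonneg _) _
    calc _ ≤ C2 * frobNorm (X - Y) ^ γ := h6
      _ ≤ KH * frobNorm (X - Y) ^ γ := by gcongr; linarith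
      _ ≤ _ := by rw [herr]; gcongr
  refine ⟨_, TransApprox.net_isTransformer hdx hn K _ hNc h w
    (Fintype.card (Fin n × (Fin dx × Fin n → Fin (K + 1))) * KH + KH) wt off F _, ?_⟩
  intro X hX
  refine (TransApprox.frob_le _ herr0 fun i j => TransApprox.net_error hdx hn K hh0 hw0 hKh hwh
    hinj hKH.le hbd herr0 hX (hmod X hX) i j).trans ?_
  have hs2 : √((dx : ℝ) * n) * √((dx : ℝ) * n) = (dx : ℝ) * n := Real.mul_self_sqrt (by positivity)
  have h1 : √((dx : ℝ) * n) * err = 2 * ((dx : ℝ) * n) * (KH * ε) := by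
    rw [herr]; linear_combination (2 * KH * ε) * hs2
  rw [h1]
  have h2 : 2 * ((dx : ℝ) * n) ≤ 4 * ((dx : ℝ) * n) ^ 2 := by nlinarith
  have h3 := mul_le_mul_of_nonneg_right h2 (by positivity : 0 ≤ KH * ε)
  linarith
end

section
/- Let n ∈ ℕ be the sequence length and let N_i ∈ T_{d_i,k_i}(D_i, H_i, S_i, W_i, L_i) for i = 1, 2 be Transformer networks. Then the map sending the vertically stacked matrix (X; Y) ∈ ℝ^{(d_1+d_2)×n} (with X ∈ ℝ^{d_1×n}, Y ∈ ℝ^{d_2×n}) to the vertically stacked output (N_1(X); N_2(Y)) ∈ ℝ^{(k_1+k_2)×n} belongs to the Transformer class T_{d_1+d_2, k_1+k_2}(D_1+D_2, H_1+H_2, max{S_1,S_2}, W_1+W_2, max{L_1,L_2}). -/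
open MeasureTheory Matrix

/-- Vertical stacking of two matrices with the same number of columns. -/
def vstack {d1 d2 n : ℕ} (X : Matrix (Fin d1) (Fin n) ℝ) (Y : Matrix (Fin d2) (Fin n) ℝ) :
    Matrix (Fin (d1 + d2)) (Fin n) ℝ :=
  Matrix.of fun i j => Fin.addCases (fun i1 => X i1 j) (fun i2 => Y i2 j) i

/-- The top `d1` rows of a vertically stacked matrix. -/
def topRows {d1 d2 n : ℕ} (Z : Matrix (Fin (d1 + d2)) (Fin n) ℝ) :
    Matrix (Fin d1) (Fin n) ℝ :=
  Matrix.of fun i j => Z (Fin.castAdd d2 i) j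

/-- The bottom `d2` rows of a vertically stacked matrix. -/
def botRows {d1 d2 n : ℕ} (Z : Matrix (Fin (d1 + d2)) (Fin n) ℝ) :
    Matrix (Fin d2) (Fin n) ℝ :=
  Matrix.of fun i j => Z (Fin.natAdd d1 i) j

def hstk {a b c : ℕ} (A : Matrix (Fin a) (Fin b) ℝ) (B : Matrix (Fin a) (Fin c) ℝ) :
    Matrix (Fin a) (Fin (b + c)) ℝ :=
  Matrix.of fun i j => Fin.addCases (fun j1 => A i j1) (fun j2 => B i j2) j

theorem hstk_mul_vstack {a b c n : ℕ} (A : Matrix (Fin a) (Fin b) ℝ) (B : Matrix (Fin a) (Fin c) ℝ)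
    (X : Matrix (Fin b) (Fin n) ℝ) (Y : Matrix (Fin c) (Fin n) ℝ) :
    hstk A B * vstack X Y = A * X + B * Y := by
  ext i j
  simp [Matrix.mul_apply, Fin.sum_univ_add, hstk, vstack]

theorem vstack_mul {a b c n : ℕ} (A : Matrix (Fin a) (Fin c) ℝ) (B : Matrix (Fin b) (Fin c) ℝ)
    (Z : Matrix (Fin c) (Fin n) ℝ) :
    vstack A B * Z = vstack (A * Z) (B * Z) := by
  ext i j
  refine Fin.addCases (fun i => ?_) (fun i => ?_) i <;> simp [Matrix.mul_apply, vstack]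

theorem vstack_transpose_mul {a b c n : ℕ} (A : Matrix (Fin a) (Fin c) ℝ)
    (B : Matrix (Fin b) (Fin c) ℝ)
    (X : Matrix (Fin a) (Fin n) ℝ) (Y : Matrix (Fin b) (Fin n) ℝ) :
    (vstack A B)ᵀ * vstack X Y = Aᵀ * X + Bᵀ * Y := by
  ext i j
  simp [Matrix.mul_apply, Fin.sum_univ_add, vstack]

theorem vstack_add {a b n : ℕ} (A C : Matrix (Fin a) (Fin n) ℝ) (B D : Matrix (Fin b) (Fin n) ℝ) :
    vstack A B + vstack C D = vstack (A + C) (B + D) := by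
  ext i j
  refine Fin.addCases (fun i => ?_) (fun i => ?_) i <;> simp [vstack]

theorem vstack_sum {a b n : ℕ} {ι : Type} [Fintype ι] (A : ι → Matrix (Fin a) (Fin n) ℝ)
    (B : ι → Matrix (Fin b) (Fin n) ℝ) :
    ∑ h, vstack (A h) (B h) = vstack (∑ h, A h) (∑ h, B h) := by
  ext i j
  refine Fin.addCases (fun i => ?_) (fun i => ?_) i <;> simp [vstack, Matrix.sum_apply]

theorem reluM_vstack {a b n : ℕ} (A : Matrix (Fin a) (Fin n) ℝ) (B : Matrix (Fin b) (Fin n) ℝ) :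
    reluM (vstack A B) = vstack (reluM A) (reluM B) := by
  ext i j
  refine Fin.addCases (fun i => ?_) (fun i => ?_) i <;> simp [vstack, reluM]

theorem bias_vstack {a b n : ℕ} (u : Fin a → ℝ) (v : Fin b → ℝ) :
    (Matrix.of fun i _ => Fin.addCases u v i : Matrix (Fin (a + b)) (Fin n) ℝ) =
      vstack (Matrix.of fun i _ => u i) (Matrix.of fun i _ => v i) := by
  ext i j
  refine Fin.addCases (fun i => ?_) (fun i => ?_) i <;> simp [vstack]

theorem vstack_top_bot {a b n : ℕ} (Z : Matrix (Fin (a + b)) (Fin n) ℝ) :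
    vstack (topRows Z) (botRows Z) = Z := by
  ext i j
  refine Fin.addCases (fun i => ?_) (fun i => ?_) i <;> simp [vstack, topRows, botRows]

theorem topRows_vstack {a b n : ℕ} (A : Matrix (Fin a) (Fin n) ℝ) (B : Matrix (Fin b) (Fin n) ℝ) :
    topRows (vstack A B) = A := by
  ext i j
  simp [vstack, topRows]

theorem botRows_vstack {a b n : ℕ} (A : Matrix (Fin a) (Fin n) ℝ) (B : Matrix (Fin b) (Fin n) ℝ) :
    botRows (vstack A B) = B := by
  ext i j
  simp [vstack, botRows]

theorem IsSelfAttn.pad {n D H S S' : ℕ} {f} (hf : IsSelfAttn n D H S f) (h : S ≤ S') :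
    IsSelfAttn n D H S' f := by
  obtain ⟨t, rfl⟩ := Nat.exists_eq_add_of_le h
  obtain ⟨WV, WK, WQ, WO, hf⟩ := hf
  refine ⟨fun h => vstack (WV h) 0, fun h => vstack (WK h) 0, fun h => vstack (WQ h) 0,
    fun h => hstk (WO h) 0, fun Z => ?_⟩
  simp [hf, vstack_mul, vstack_transpose_mul, hstk_mul_vstack]

theorem IsSelfAttn.stack {n D1 D2 H1 H2 S : ℕ} {f g} (hf : IsSelfAttn n D1 H1 S f)
    (hg : IsSelfAttn n D2 H2 S g) :
    IsSelfAttn n (D1 + D2) (H1 + H2) S (fun Z => vstack (f (topRows Z)) (g (botRows Z))) := by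
  obtain ⟨WV, WK, WQ, WO, hf⟩ := hf
  obtain ⟨WV', WK', WQ', WO', hg⟩ := hg
  refine ⟨Fin.addCases (fun h => hstk (WV h) 0) (fun h => hstk 0 (WV' h)),
    Fin.addCases (fun h => hstk (WK h) 0) (fun h => hstk 0 (WK' h)),
    Fin.addCases (fun h => hstk (WQ h) 0) (fun h => hstk 0 (WQ' h)),
    Fin.addCases (fun h => vstack (WO h) 0) (fun h => vstack 0 (WO' h)), fun Z => ?_⟩
  obtain ⟨X, Y, rfl⟩ : ∃ X Y, Z = vstack X Y := ⟨_, _, (vstack_top_bot Z).symm⟩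
  simp [-Matrix.transpose_mul, hf, hg, topRows_vstack, botRows_vstack, Fin.sum_univ_add, hstk_mul_vstack, vstack_mul,
    vstack_sum, vstack_add]

theorem IsFeedForward.stack {n D1 D2 W1 W2 : ℕ} {f g} (hf : IsFeedForward n D1 W1 f)
    (hg : IsFeedForward n D2 W2 g) :
    IsFeedForward n (D1 + D2) (W1 + W2) (fun Z => vstack (f (topRows Z)) (g (botRows Z))) := by
  obtain ⟨A, B, b, c, hf⟩ := hf
  obtain ⟨A', B', b', c', hg⟩ := hg
  refine ⟨vstack (hstk A 0) (hstk 0 A'), vstack (hstk B 0) (hstk 0 B'), Fin.addCases b b',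
    Fin.addCases c c', fun Z => ?_⟩
  obtain ⟨X, Y, rfl⟩ : ∃ X Y, Z = vstack X Y := ⟨_, _, (vstack_top_bot Z).symm⟩
  simp [hf, hg, topRows_vstack, botRows_vstack, hstk_mul_vstack, vstack_mul, bias_vstack,
    reluM_vstack, vstack_add]

theorem IsTransformer.pad {n dx dy D H S S' W L L' : ℕ} {f}
    (hf : IsTransformer n dx dy D H S W L f) (hS : S ≤ S') (hL : L ≤ L') :
    IsTransformer n dx dy D H S' W L' f := by
  induction hL with
  | refl =>
    obtain ⟨A, P, B, SA, FF, h1, h2, h3⟩ := hf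
    exact ⟨A, P, B, SA, FF, fun l => (h1 l).pad hS, h2, h3⟩
  | @step m _ ih =>
    obtain ⟨A, P, B, SA, FF, h1, h2, h3⟩ := ih
    refine ⟨A, P, B, Fin.snoc (α := fun _ => _) SA id, Fin.snoc (α := fun _ => _) FF id,
      fun l => ?_, fun l => ?_, fun X => ?_⟩
    · refine Fin.lastCases ?_ (fun l => ?_) l
      · exact ⟨0, 0, 0, 0, fun Z => by simp⟩
      · simpa using h1 l
    · refine Fin.lastCases ?_ (fun l => ?_) l
      · exact ⟨0, 0, 0, 0, fun Z => by ext; simp⟩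
      · simpa using h2 l
    · rw [h3, Fin.foldl_succ_last]
      simp

theorem foldl_vstack {n D1 D2 : ℕ} (L : ℕ)
    (F : Fin L → Matrix (Fin D1) (Fin n) ℝ → Matrix (Fin D1) (Fin n) ℝ)
    (G : Fin L → Matrix (Fin D2) (Fin n) ℝ → Matrix (Fin D2) (Fin n) ℝ) (X Y) :
    Fin.foldl L (fun Z l => vstack (F l (topRows Z)) (G l (botRows Z))) (vstack X Y) =
      vstack (Fin.foldl L (fun Z l => F l Z) X) (Fin.foldl L (fun Z l => G l Z) Y) := by
  induction L with
  | zero => simp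
  | succ L ih =>
    rw [Fin.foldl_succ_last, Fin.foldl_succ_last, Fin.foldl_succ_last,
      ih (fun l => F l.castSucc) (fun l => G l.castSucc), topRows_vstack, botRows_vstack]

/-- Proposition 1 (2), concatenation: stacking two transformer networks
yields a transformer network whose size parameters add (resp. take maxima). -/
theorem transformer_concat
    (n d1 d2 k1 k2 D1 D2 H1 H2 S1 S2 W1 W2 L1 L2 : ℕ)
    (N1 : Matrix (Fin d1) (Fin n) ℝ → Matrix (Fin k1) (Fin n) ℝ)
    (N2 : Matrix (Fin d2) (Fin n) ℝ → Matrix (Fin k2) (Fin n) ℝ)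
    (hN1 : IsTransformer n d1 k1 D1 H1 S1 W1 L1 N1)
    (hN2 : IsTransformer n d2 k2 D2 H2 S2 W2 L2 N2) :
    IsTransformer n (d1 + d2) (k1 + k2) (D1 + D2) (H1 + H2) (max S1 S2) (W1 + W2)
      (max L1 L2) (fun Z => vstack (N1 (topRows Z)) (N2 (botRows Z))) := by
  obtain ⟨A, P, B, SA, FF, h1, h2, h3⟩ := hN1.pad (le_max_left S1 S2) (le_max_left L1 L2)
  obtain ⟨A', P', B', SA', FF', h1', h2', h3'⟩ :=
    hN2.pad (le_max_right S1 S2) (le_max_right L1 L2)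
  refine ⟨vstack (hstk A 0) (hstk 0 A'), vstack P P', vstack (hstk B 0) (hstk 0 B'), _, _,
    fun l => (h1 l).stack (h1' l), fun l => (h2 l).stack (h2' l), fun Z => ?_⟩
  obtain ⟨X, Y, rfl⟩ : ∃ X Y, Z = vstack X Y := ⟨_, _, (vstack_top_bot Z).symm⟩
  have key := foldl_vstack (max L1 L2) (fun l Z => FF l (SA l Z)) (fun l Z => FF' l (SA' l Z))
    (A * X + P) (A' * Y + P')
  simp only [topRows_vstack, botRows_vstack, vstack_mul, hstk_mul_vstack, vstack_add,
    Matrix.zero_mul, add_zero, zero_add, h3, h3'] at key ⊢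
  rw [key, hstk_mul_vstack, hstk_mul_vstack]
  simp
end

section
/- Let n ∈ ℕ be the sequence length, and let N_1 ∈ T_{d,k}(D_1, H_1, S_1, W_1, L_1) and N_2 ∈ T_{d,k}(D_2, H_2, S_2, W_2, L_2) be Transformer networks with the same input dimension d and output dimension k. Then the pointwise sum N_1 + N_2 belongs to the Transformer class T_{d,k}(D_1+D_2, H_1+H_2, max{S_1,S_2}, W_1+W_2, max{L_1,L_2}). -/
open MeasureTheory Matrix

/-- The 0-1 matrix embedding coordinates along `f`. -/
def embM {a b : ℕ} (f : Fin a → Fin b) : Matrix (Fin b) (Fin a) ℝ :=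
  Matrix.of fun i j => if i = f j then 1 else 0

lemma embM_self {a b : ℕ} (f : Fin a → Fin b) (hf : Function.Injective f) :
    (embM f)ᵀ * embM f = 1 := by
  ext i j
  simp [embM, Matrix.mul_apply, Matrix.one_apply, hf.eq_iff, eq_comm]

lemma embM_disj {a a' b : ℕ} (f : Fin a → Fin b) (g : Fin a' → Fin b)
    (h : ∀ i j, f i ≠ g j) : (embM f)ᵀ * embM g = 0 := by
  ext i j
  simp [embM, Matrix.mul_apply, (h _ _).symm]

/-- Embedding into the first coordinates. -/
def embL (a b : ℕ) : Matrix (Fin (a + b)) (Fin a) ℝ := embM (Fin.castAdd b)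

/-- Embedding into the last coordinates. -/
def embR (a b : ℕ) : Matrix (Fin (a + b)) (Fin b) ℝ := embM (Fin.natAdd a)

/-- Vertical stacking of two matrices. -/
def stk {a b n : ℕ} (A : Matrix (Fin a) (Fin n) ℝ) (B : Matrix (Fin b) (Fin n) ℝ) :
    Matrix (Fin (a + b)) (Fin n) ℝ :=
  embL a b * A + embR a b * B

lemma castAdd_ne_natAdd' {a b : ℕ} (i : Fin a) (j : Fin b) :
    Fin.castAdd b i ≠ Fin.natAdd a j := by
  intro h
  have := congrArg Fin.val h
  simp at this
  omega

lemma fst_stk {a b n : ℕ} (A : Matrix (Fin a) (Fin n) ℝ) (B : Matrix (Fin b) (Fin n) ℝ) :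
    (embL a b)ᵀ * stk A B = A := by
  rw [stk, Matrix.mul_add, ← Matrix.mul_assoc, ← Matrix.mul_assoc, embL, embR,
    embM_self _ (Fin.castAdd_injective a b), embM_disj _ _ castAdd_ne_natAdd']
  simp

lemma snd_stk {a b n : ℕ} (A : Matrix (Fin a) (Fin n) ℝ) (B : Matrix (Fin b) (Fin n) ℝ) :
    (embR a b)ᵀ * stk A B = B := by
  rw [stk, Matrix.mul_add, ← Matrix.mul_assoc, ← Matrix.mul_assoc, embL, embR,
    embM_self _ (Fin.natAdd_injective b a),
    embM_disj _ _ (fun i j => (castAdd_ne_natAdd' j i).symm)]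
  simp

lemma stk_castAdd {a b n : ℕ} (A : Matrix (Fin a) (Fin n) ℝ) (B : Matrix (Fin b) (Fin n) ℝ)
    (i : Fin a) (j : Fin n) : stk A B (Fin.castAdd b i) j = A i j := by
  simp [stk, embL, embR, embM, Matrix.mul_apply, castAdd_ne_natAdd']

lemma stk_natAdd {a b n : ℕ} (A : Matrix (Fin a) (Fin n) ℝ) (B : Matrix (Fin b) (Fin n) ℝ)
    (i : Fin b) (j : Fin n) : stk A B (Fin.natAdd a i) j = B i j := by
  simp [stk, embL, embR, embM, Matrix.mul_apply, (castAdd_ne_natAdd' _ _).symm]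

lemma stk_add {a b n : ℕ} (A A' : Matrix (Fin a) (Fin n) ℝ) (B B' : Matrix (Fin b) (Fin n) ℝ) :
    stk (A + A') (B + B') = stk A B + stk A' B' := by
  simp only [stk, Matrix.mul_add]; abel

lemma reluM_stk {a b n : ℕ} (A : Matrix (Fin a) (Fin n) ℝ) (B : Matrix (Fin b) (Fin n) ℝ) :
    reluM (stk A B) = stk (reluM A) (reluM B) := by
  ext i j
  refine Fin.addCases (fun i => ?_) (fun i => ?_) i
  · rw [stk_castAdd]; simp [reluM, stk_castAdd]
  · rw [stk_natAdd]; simp [reluM, stk_natAdd]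

lemma bias_stk {a b n : ℕ} (u : Fin a → ℝ) (v : Fin b → ℝ) :
    (Matrix.of fun i (_ : Fin n) => Fin.append u v i) =
      stk (Matrix.of fun i _ => u i) (Matrix.of fun i _ => v i) := by
  ext i j
  refine Fin.addCases (fun i => ?_) (fun i => ?_) i
  · rw [stk_castAdd]; simp
  · rw [stk_natAdd]; simp

/-- Block diagonal matrix. -/
def bdiag {a b a' b' : ℕ} (M : Matrix (Fin a') (Fin a) ℝ) (N : Matrix (Fin b') (Fin b) ℝ) :
    Matrix (Fin (a' + b')) (Fin (a + b)) ℝ :=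
  embL a' b' * (M * (embL a b)ᵀ) +
    embR a' b' * (N * (embR a b)ᵀ)

lemma bdiag_stk {a b a' b' n : ℕ} (M : Matrix (Fin a') (Fin a) ℝ)
    (N : Matrix (Fin b') (Fin b) ℝ)
    (A : Matrix (Fin a) (Fin n) ℝ) (B : Matrix (Fin b) (Fin n) ℝ) :
    bdiag M N * stk A B = stk (M * A) (N * B) := by
  rw [bdiag, Matrix.add_mul, Matrix.mul_assoc, Matrix.mul_assoc, Matrix.mul_assoc,
    Matrix.mul_assoc, fst_stk, snd_stk, stk]

lemma ff_stk {n D1 D2 W1 W2 : ℕ} {f g}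
    (hf : IsFeedForward n D1 W1 f) (hg : IsFeedForward n D2 W2 g) :
    ∃ F, IsFeedForward n (D1 + D2) (W1 + W2) F ∧
      ∀ A B, F (stk A B) = stk (f A) (g B) := by
  obtain ⟨U, V, b, c, hf⟩ := hf
  obtain ⟨U', V', b', c', hg⟩ := hg
  refine ⟨_, ⟨bdiag U U', bdiag V V', Fin.append b b', Fin.append c c', fun Z => rfl⟩, ?_⟩
  intro A B
  rw [bias_stk, bias_stk, bdiag_stk, ← stk_add, reluM_stk, bdiag_stk, ← stk_add, ← stk_add,
    hf, hg]

lemma head_emb {n D D' S S' : ℕ} (P : Matrix (Fin D) (Fin D') ℝ) (E : Matrix (Fin D') (Fin D) ℝ)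
    (J : Matrix (Fin S') (Fin S) ℝ) (hJ : Jᵀ * J = 1)
    (V K Q : Matrix (Fin S) (Fin D) ℝ) (O : Matrix (Fin D) (Fin S) ℝ)
    (Z : Matrix (Fin D') (Fin n) ℝ) (A : Matrix (Fin D) (Fin n) ℝ) (hZ : P * Z = A) :
    (E * (O * Jᵀ)) * (((J * (V * P)) * Z) *
        softmaxCol (((J * (K * P)) * Z)ᵀ * ((J * (Q * P)) * Z))) =
      E * (O * ((V * A) * softmaxCol ((K * A)ᵀ * (Q * A)))) := by
  have hJ' : ∀ {m : ℕ} (M : Matrix (Fin S) (Fin m) ℝ), Jᵀ * (J * M) = M := by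
    intro m M; rw [← Matrix.mul_assoc, hJ, Matrix.one_mul]
  have e : ∀ M : Matrix (Fin S) (Fin D) ℝ, (J * (M * P)) * Z = J * (M * A) := by
    intro M; rw [Matrix.mul_assoc, Matrix.mul_assoc, hZ]
  rw [e, e, e, Matrix.transpose_mul J, Matrix.mul_assoc (K * A)ᵀ, hJ', Matrix.mul_assoc E,
    Matrix.mul_assoc O, Matrix.mul_assoc J, hJ']

lemma sa_stk {n D1 D2 H1 H2 S1 S2 : ℕ} {f g}
    (hf : IsSelfAttn n D1 H1 S1 f) (hg : IsSelfAttn n D2 H2 S2 g) :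
    ∃ F, IsSelfAttn n (D1 + D2) (H1 + H2) (max S1 S2) F ∧
      ∀ A B, F (stk A B) = stk (f A) (g B) := by
  obtain ⟨V, K, Q, O, hf⟩ := hf
  obtain ⟨V', K', Q', O', hg⟩ := hg
  have h1 := embM_self _ (Fin.castLE_injective (le_max_left S1 S2))
  have h2 := embM_self _ (Fin.castLE_injective (le_max_right S1 S2))
  set J := embM (Fin.castLE (le_max_left S1 S2))
  set J' := embM (Fin.castLE (le_max_right S1 S2))
  set P : Matrix (Fin D1) (Fin (D1 + D2)) ℝ := (embL D1 D2)ᵀ with hP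
  set P' : Matrix (Fin D2) (Fin (D1 + D2)) ℝ := (embR D1 D2)ᵀ with hP'
  refine ⟨_, ⟨Fin.append (fun h => J * (V h * P)) (fun h => J' * (V' h * P')),
    Fin.append (fun h => J * (K h * P)) (fun h => J' * (K' h * P')),
    Fin.append (fun h => J * (Q h * P)) (fun h => J' * (Q' h * P')),
    Fin.append (fun h => embL D1 D2 * (O h * Jᵀ))
      (fun h => embR D1 D2 * (O' h * J'ᵀ)), fun Z => rfl⟩, ?_⟩
  intro A B
  simp only [Fin.sum_univ_add, Fin.append_left, Fin.append_right]
  simp only [head_emb P _ J h1 _ _ _ _ (stk A B) A (fst_stk A B),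
    head_emb P' _ J' h2 _ _ _ _ (stk A B) B (snd_stk A B)]
  rw [hf, hg, stk_add, ← Matrix.mul_sum, ← Matrix.mul_sum]
  rfl

lemma foldl_stk {n D1 D2 : ℕ} (L : ℕ)
    (f : Matrix (Fin D1) (Fin n) ℝ → Fin L → Matrix (Fin D1) (Fin n) ℝ)
    (g : Matrix (Fin D2) (Fin n) ℝ → Fin L → Matrix (Fin D2) (Fin n) ℝ)
    (F : Matrix (Fin (D1 + D2)) (Fin n) ℝ → Fin L → Matrix (Fin (D1 + D2)) (Fin n) ℝ)
    (h : ∀ l A B, F (stk A B) l = stk (f A l) (g B l)) (A B) :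
    Fin.foldl L F (stk A B) = stk (Fin.foldl L f A) (Fin.foldl L g B) := by
  induction L with
  | zero => simp
  | succ L ih =>
    rw [Fin.foldl_succ_last, Fin.foldl_succ_last, Fin.foldl_succ_last,
      ih (fun A l => f A l.castSucc) (fun A l => g A l.castSucc) (fun A l => F A l.castSucc)
        (fun l A B => h _ _ _), h]

lemma transformer_succ {n dx dy D H S W L : ℕ} {f}
    (hf : IsTransformer n dx dy D H S W L f) : IsTransformer n dx dy D H S W (L + 1) f := by
  obtain ⟨Ain, P, Aout, SA, FF, hS, hF, h⟩ := hf
  refine ⟨Ain, P, Aout, Fin.snoc (α := fun _ => _) SA id, Fin.snoc (α := fun _ => _) FF id,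
    ?_, ?_, ?_⟩
  · intro l
    refine Fin.lastCases ?_ (fun l => ?_) l
    · rw [Fin.snoc_last]
      exact ⟨0, 0, 0, 0, fun Z => by simp⟩
    · rw [Fin.snoc_castSucc]; exact hS l
  · intro l
    refine Fin.lastCases ?_ (fun l => ?_) l
    · rw [Fin.snoc_last]
      refine ⟨0, 0, 0, 0, fun Z => ?_⟩
      ext i j
      simp
    · rw [Fin.snoc_castSucc]; exact hF l
  · intro X
    rw [h, Fin.foldl_succ_last]
    simp only [Fin.snoc_castSucc, Fin.snoc_last, id]

lemma transformer_mono {n dx dy D H S W L L' : ℕ} {f} (hL : L ≤ L')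
    (hf : IsTransformer n dx dy D H S W L f) : IsTransformer n dx dy D H S W L' f := by
  induction hL with
  | refl => exact hf
  | step _ ih => exact transformer_succ ih

/-- Proposition 1 (3), summation: the pointwise sum of two transformer
networks with matching input/output dimensions is a transformer network whose size
parameters add (resp. take maxima). -/
theorem transformer_sum
    (n d k D1 D2 H1 H2 S1 S2 W1 W2 L1 L2 : ℕ)
    (N1 N2 : Matrix (Fin d) (Fin n) ℝ → Matrix (Fin k) (Fin n) ℝ)
    (hN1 : IsTransformer n d k D1 H1 S1 W1 L1 N1)
    (hN2 : IsTransformer n d k D2 H2 S2 W2 L2 N2) :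
    IsTransformer n d k (D1 + D2) (H1 + H2) (max S1 S2) (W1 + W2) (max L1 L2)
      (fun X => N1 X + N2 X) := by
  have hN1 := transformer_mono (le_max_left L1 L2) hN1
  have hN2 := transformer_mono (le_max_right L1 L2) hN2
  obtain ⟨Ain, P, Aout, SA, FF, hS, hF, h⟩ := hN1
  obtain ⟨Ain', P', Aout', SA', FF', hS', hF', h'⟩ := hN2
  choose SA'' hS'' hSS using fun l => sa_stk (hS l) (hS' l)
  choose FF'' hF'' hFF using fun l => ff_stk (hF l) (hF' l)
  refine ⟨embL D1 D2 * Ain + embR D1 D2 * Ain', stk P P',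
    Aout * (embL D1 D2)ᵀ + Aout' * (embR D1 D2)ᵀ, SA'', FF'', hS'', hF'', ?_⟩
  intro X
  have e : (embL D1 D2 * Ain + embR D1 D2 * Ain') * X + stk P P' =
      stk (Ain * X + P) (Ain' * X + P') := by
    rw [stk_add, stk, Matrix.add_mul, Matrix.mul_assoc, Matrix.mul_assoc]; rfl
  rw [e, foldl_stk _ (fun Z l => FF l (SA l Z)) (fun Z l => FF' l (SA' l Z)) _
    (fun l A B => by rw [hSS, hFF]), Matrix.add_mul, Matrix.mul_assoc, Matrix.mul_assoc,
    fst_stk, snd_stk, ← h, ← h']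
end
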